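/- arXiv:2402.13342 — 7 statements merged into one kernel-verified Lean document; each statement's English description precedes it below -/
import Mathlib

section
/- For every set S of n upward unit triangles in Δ, there exists a fine mixed subdivision of Δ with hole set S if and only if S is spread-out. -/
/-- The upward unit triangles of the side-`n` triangle Δ: pairs `(i,j)` with `i+j ≤ n-1`. -/
def UpTri (n : ℕ) : Set (ℕ × ℕ) := {p | p.1 + p.2 + 1 ≤ n}

/-- The downward unit triangles of Δ: pairs `(i,j)` with `i+j ≤ n-2`. -/
def DownTri (n : ℕ) : Set (ℕ × ℕ) := {p | p.1 + p.2 + 2 ≤ n}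

/-- The downward unit triangle `d` is adjacent to exactly the upward unit triangles
`d`, `(d.1+1, d.2)` and `(d.1, d.2+1)`. -/
def Adj (d u : ℕ × ℕ) : Prop :=
  u = d ∨ u = (d.1 + 1, d.2) ∨ u = (d.1, d.2 + 1)

/-- A fine mixed subdivision (tiling) of Δ with hole set `S`: a bijection `f` from the
downward unit triangles onto the upward unit triangles not in `S`, with `f d` adjacent
to `d` for every `d`. -/
def IsTiling (n : ℕ) (S : Set (ℕ × ℕ)) (f : ℕ × ℕ → ℕ × ℕ) : Prop :=
  Set.BijOn f (DownTri n) (UpTri n \ S) ∧ ∀ d ∈ DownTri n, Adj d (f d)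

/-- The upward unit triangles of the upward subtriangle `T(a,b,k)`. -/
def UpCells (a b k : ℕ) : Set (ℕ × ℕ) :=
  {p | a ≤ p.1 ∧ b ≤ p.2 ∧ p.1 + p.2 + 1 ≤ a + b + k}

/-- The downward unit triangles of the upward subtriangle `T(a,b,k)`. -/
def DownCells (a b k : ℕ) : Set (ℕ × ℕ) :=
  {p | a ≤ p.1 ∧ b ≤ p.2 ∧ p.1 + p.2 + 2 ≤ a + b + k}

/-- `S` is spread-out: every upward subtriangle of size `k` contains at most `k` holes. -/
def SpreadOut (n : ℕ) (S : Finset (ℕ × ℕ)) : Prop :=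
  ∀ a b k : ℕ, a + b + k ≤ n →
    (S.filter (fun p => a ≤ p.1 ∧ b ≤ p.2 ∧ p.1 + p.2 + 1 ≤ a + b + k)).card ≤ k

open Finset in
/-- The upward cells of `T(a,b,k)` as a finset. -/
def upF (a b k : ℕ) : Finset (ℕ × ℕ) :=
  ((range (a+b+k)) ×ˢ (range (a+b+k))).filter
    (fun p => a ≤ p.1 ∧ b ≤ p.2 ∧ p.1 + p.2 + 1 ≤ a + b + k)

open Finset in
/-- The downward cells of `T(a,b,k)` as a finset. -/
def downF (a b k : ℕ) : Finset (ℕ × ℕ) :=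
  ((range (a+b+k)) ×ˢ (range (a+b+k))).filter
    (fun p => a ≤ p.1 ∧ b ≤ p.2 ∧ p.1 + p.2 + 2 ≤ a + b + k)

theorem mem_upF {a b k i j : ℕ} :
    (i, j) ∈ upF a b k ↔ a ≤ i ∧ b ≤ j ∧ i + j + 1 ≤ a + b + k := by
  simp only [upF, Finset.mem_filter, Finset.mem_product, Finset.mem_range]
  omega

theorem mem_downF {a b k i j : ℕ} :
    (i, j) ∈ downF a b k ↔ a ≤ i ∧ b ≤ j ∧ i + j + 2 ≤ a + b + k := by
  simp only [downF, Finset.mem_filter, Finset.mem_product, Finset.mem_range]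
  omega

theorem card_upF_succ (a b k : ℕ) :
    (upF a b (k+1)).card = (upF a b k).card + (k + 1) := by
  have h : upF a b (k+1) = upF a b k ∪
      (Finset.range (k+1)).image (fun t => (a + t, b + k - t)) := by
    ext ⟨i, j⟩
    simp only [Finset.mem_union, mem_upF, Finset.mem_image, Finset.mem_range, Prod.mk.injEq]
    constructor
    · intro h
      by_cases h2 : i + j + 1 ≤ a + b + k
      · left; omega
      · right; exact ⟨i - a, by omega, by omega, by omega⟩
    · rintro (h | ⟨t, h1, h2, h3⟩) <;> omega
  rw [h, Finset.card_union_of_disjoint, Finset.card_image_of_injOn, Finset.card_range]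
  · intro s _ t _ hst
    simp only [Prod.mk.injEq] at hst
    omega
  · rw [Finset.disjoint_left]
    rintro ⟨i, j⟩ h1 h2
    simp only [mem_upF, Finset.mem_image, Finset.mem_range, Prod.mk.injEq] at h1 h2
    obtain ⟨t, h2, h3, h4⟩ := h2
    omega

theorem card_up_down (a b k : ℕ) : (upF a b k).card = (downF a b k).card + k := by
  cases k with
  | zero =>
    have h1 : upF a b 0 = ∅ := by
      apply Finset.eq_empty_of_forall_notMem
      rintro ⟨i, j⟩ h
      rw [mem_upF] at h; omega
    simp [h1, show downF a b 0 = ∅ from by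
      apply Finset.eq_empty_of_forall_notMem
      rintro ⟨i, j⟩ h
      rw [mem_downF] at h; omega]
  | succ k =>
    rw [card_upF_succ]
    congr 2
    ext ⟨i, j⟩
    rw [mem_upF, mem_downF]; omega

/-- Downward cells all of whose neighbours lie in `U`. -/
def innerD (U : Finset (ℕ × ℕ)) : Finset (ℕ × ℕ) :=
  U.filter (fun d => (d.1 + 1, d.2) ∈ U ∧ (d.1, d.2 + 1) ∈ U)

theorem mem_innerD {U : Finset (ℕ × ℕ)} {i j : ℕ} :
    (i, j) ∈ innerD U ↔ (i, j) ∈ U ∧ (i + 1, j) ∈ U ∧ (i, j + 1) ∈ U := by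
  simp [innerD]

/-- Two of three neighbours in `U` force the third. -/
def Clo (U : Finset (ℕ × ℕ)) : Prop :=
  ∀ i j : ℕ, ((i, j) ∈ U → (i + 1, j) ∈ U → (i, j + 1) ∈ U) ∧
    ((i, j) ∈ U → (i, j + 1) ∈ U → (i + 1, j) ∈ U) ∧
    ((i + 1, j) ∈ U → (i, j + 1) ∈ U → (i, j) ∈ U)

theorem chain {Q : ℕ → Prop} {k t : ℕ} (h : ∀ s, s < k → (Q s ↔ Q (s+1)))
    (ht : t ≤ k) (hQ : Q t) : ∀ s, s ≤ k → Q s := by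
  have h0 : ∀ s, s ≤ k → (Q 0 ↔ Q s) := by
    intro s
    induction s with
    | zero => intro _; exact Iff.rfl
    | succ s ih => intro hs; exact (ih (by omega)).trans (h s (by omega))
  intro s hs
  exact (h0 s hs).1 ((h0 t ht).2 hQ)

/-- A nonempty closed set contains a triangle with no neighbour in the set. -/
theorem exists_sep {n : ℕ} {U : Finset (ℕ × ℕ)} (hU : U ⊆ upF 0 0 n) (hc : Clo U)
    (hne : U.Nonempty) : ∃ a b k : ℕ, 0 < k ∧ a + b + k ≤ n ∧ upF a b k ⊆ U ∧
      (∀ i j, (i, j) ∈ U → ¬ (i + 1 = a ∧ b ≤ j ∧ j ≤ b + k)) ∧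
      (∀ i j, (i, j) ∈ U → ¬ (j + 1 = b ∧ a ≤ i ∧ i ≤ a + k)) ∧
      (∀ i j, (i, j) ∈ U → ¬ (i + j = a + b + k ∧ a ≤ i ∧ b ≤ j)) := by
  classical
  let P : ℕ → Prop := fun k => ∃ a b, upF a b (k+1) ⊆ U
  have hbd : ∀ a b k, upF a b (k+1) ⊆ U → a + b + (k+1) ≤ n := by
    intro a b k h
    have h1 : (a + k, b) ∈ upF 0 0 n := hU (h (by rw [mem_upF]; omega))
    rw [mem_upF] at h1; omega
  have hP0 : P 0 := by
    obtain ⟨⟨i, j⟩, hij⟩ := hne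
    refine ⟨i, j, ?_⟩
    rintro ⟨x, y⟩ h
    rw [mem_upF] at h
    obtain rfl : x = i := by omega
    obtain rfl : y = j := by omega
    exact hij
  have hPk : P (Nat.findGreatest P n) := Nat.findGreatest_spec (Nat.zero_le n) hP0
  have hmax : ∀ m, P m → m ≤ Nat.findGreatest P n := by
    intro m hm
    obtain ⟨a, b, h⟩ := hm
    exact Nat.le_findGreatest (by have := hbd a b m h; omega) ⟨a, b, h⟩
  generalize Nat.findGreatest P n = k at hPk hmax
  obtain ⟨a, b, hT⟩ := hPk
  have hbig : ∀ a b, ¬ upF a b (k+1+1) ⊆ U := fun a b h => by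
    have := hmax (k+1) ⟨a, b, h⟩; omega
  have hT' : ∀ i j, a ≤ i → b ≤ j → i + j + 1 ≤ a + b + (k+1) → (i, j) ∈ U :=
    fun i j h1 h2 h3 => hT (mem_upF.2 ⟨h1, h2, h3⟩)
  refine ⟨a, b, k+1, by omega, hbd a b k hT, hT, ?_, ?_, ?_⟩
  · rintro i j hij ⟨rfl, h2, h3⟩
    have hch := chain (Q := fun s => (i, b + s) ∈ U) (k := k+1) (t := j - b) (by
      intro s hs
      have h1 := hT' (i+1) (b+s) (by omega) (by omega) (by omega)
      exact ⟨fun h => (hc i (b+s)).1 h h1, fun h => (hc i (b+s)).2.2 h1 h⟩) (by omega)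
      (by simpa [show b + (j - b) = j by omega] using hij)
    apply hbig i b
    rintro ⟨x, y⟩ h
    rw [mem_upF] at h
    by_cases hx : x = i
    · subst hx
      have := hch (y - b) (by omega)
      simpa [show b + (y - b) = y by omega] using this
    · exact hT' x y (by omega) (by omega) (by omega)
  · rintro i j hij ⟨rfl, h2, h3⟩
    have hch := chain (Q := fun s => (a + s, j) ∈ U) (k := k+1) (t := i - a) (by
      intro s hs
      have h1 := hT' (a+s) (j+1) (by omega) (by omega) (by omega)
      exact ⟨fun h => (hc (a+s) j).2.1 h h1, fun h => (hc (a+s) j).2.2 h h1⟩) (by omega)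
      (by simpa [show a + (i - a) = i by omega] using hij)
    apply hbig a j
    rintro ⟨x, y⟩ h
    rw [mem_upF] at h
    by_cases hx : y = j
    · subst hx
      have := hch (x - a) (by omega)
      simpa [show a + (x - a) = x by omega] using this
    · exact hT' x y (by omega) (by omega) (by omega)
  · rintro i j hij ⟨h1, h2, h3⟩
    have hch := chain (Q := fun s => (a + s, b + (k+1) - s) ∈ U) (k := k+1) (t := i - a) (by
      intro s hs
      have h1 := hT' (a+s) (b+k-s) (by omega) (by omega) (by omega)
      have e : b + (k+1) - s = b + k - s + 1 := by omega
      have e' : b + (k+1) - (s+1) = b + k - s := by omega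
      rw [e, e']
      exact ⟨fun h => (hc (a+s) (b+k-s)).2.1 h1 h, fun h => (hc (a+s) (b+k-s)).1 h1 h⟩)
      (by omega)
      (by simpa [show a + (i - a) = i by omega, show b + (k+1) - (i - a) = j by omega] using hij)
    apply hbig a b
    rintro ⟨x, y⟩ h
    rw [mem_upF] at h
    by_cases hx : x + y = a + b + (k+1)
    · have := hch (x - a) (by omega)
      simpa [show a + (x - a) = x by omega, show b + (k+1) - (x - a) = y by omega] using this
    · exact hT' x y (by omega) (by omega) (by omega)

theorem count_closed {n : ℕ} {S : Finset (ℕ × ℕ)} (hS : SpreadOut n S) :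
    ∀ (m : ℕ) (U : Finset (ℕ × ℕ)), U.card ≤ m → U ⊆ upF 0 0 n → Clo U →
      (S ∩ U).card + (innerD U).card ≤ U.card := by
  intro m
  induction m with
  | zero =>
    intro U h _ _
    have : U = ∅ := by simpa using h
    subst this
    simp [innerD]
  | succ m ih =>
    intro U hm hU hc
    rcases U.eq_empty_or_nonempty with rfl | hne
    · simp [innerD]
    obtain ⟨a, b, k, hk, hn, hT, hA, hB, hC⟩ := exists_sep hU hc hne
    have key : ∀ i j, (i, j) ∈ U → (i+1, j) ∈ U → (i, j+1) ∈ U →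
        ((i, j) ∈ upF a b k ∧ (i+1, j) ∈ upF a b k ∧ (i, j+1) ∈ upF a b k) ∨
        ((i, j) ∉ upF a b k ∧ (i+1, j) ∉ upF a b k ∧ (i, j+1) ∉ upF a b k) := by
      intro i j h1 h2 h3
      have a1 := hA _ _ h1
      have a2 := hA _ _ h2
      have a3 := hA _ _ h3
      have b1 := hB _ _ h1
      have b2 := hB _ _ h2
      have b3 := hB _ _ h3
      have c1 := hC _ _ h1
      have c2 := hC _ _ h2
      have c3 := hC _ _ h3
      simp only [mem_upF]
      omega
    have hcU : (upF a b k).card + (U \ upF a b k).card = U.card := by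
      rw [add_comm]; exact Finset.card_sdiff_add_card_eq_card hT
    have hTpos : 0 < (upF a b k).card := by
      have := card_up_down a b k; omega
    have hclo : Clo (U \ upF a b k) := by
      intro i j
      have hk1 := key i j
      have hc1 := hc i j
      simp only [Finset.mem_sdiff]
      refine ⟨fun h1 h2 => ?_, fun h1 h2 => ?_, fun h1 h2 => ?_⟩
      · have h3 := hc1.1 h1.1 h2.1
        rcases hk1 h1.1 h2.1 h3 with h | h
        · exact absurd h.1 h1.2
        · exact ⟨h3, h.2.2⟩
      · have h3 := hc1.2.1 h1.1 h2.1
        rcases hk1 h1.1 h3 h2.1 with h | h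
        · exact absurd h.1 h1.2
        · exact ⟨h3, h.2.1⟩
      · have h3 := hc1.2.2 h1.1 h2.1
        rcases hk1 h3 h1.1 h2.1 with h | h
        · exact absurd h.2.1 h1.2
        · exact ⟨h3, h.1⟩
    have hrec := ih (U \ upF a b k) (by omega) (Finset.sdiff_subset.trans hU) hclo
    have hinner : (innerD U).card ≤ (downF a b k).card + (innerD (U \ upF a b k)).card := by
      refine le_trans (Finset.card_le_card ?_) (Finset.card_union_le _ _)
      rintro ⟨i, j⟩ h
      rw [mem_innerD] at h
      rw [Finset.mem_union, mem_innerD, mem_downF]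
      simp only [Finset.mem_sdiff]
      rcases key i j h.1 h.2.1 h.2.2 with h' | h'
      · left
        simp only [mem_upF] at h'
        omega
      · right; tauto
    have hSk : (S ∩ upF a b k).card ≤ k := by
      refine le_trans (Finset.card_le_card ?_) (hS a b k hn)
      rintro ⟨i, j⟩ h
      rw [Finset.mem_inter, mem_upF] at h
      rw [Finset.mem_filter]
      exact h
    have hSU : (S ∩ U).card ≤ (S ∩ upF a b k).card + (S ∩ (U \ upF a b k)).card := by
      refine le_trans (Finset.card_le_card ?_) (Finset.card_union_le _ _)
      intro p h
      simp only [Finset.mem_union, Finset.mem_inter, Finset.mem_sdiff] at *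
      tauto
    have := card_up_down a b k
    omega

theorem count_add {S U : Finset (ℕ × ℕ)} {u d : ℕ × ℕ} (hu : u ∉ U)
    (hd : d ∈ innerD (insert u U)) (hd' : d ∉ innerD U)
    (h : (S ∩ insert u U).card + (innerD (insert u U)).card ≤ (insert u U).card) :
    (S ∩ U).card + (innerD U).card ≤ U.card := by
  rw [Finset.card_insert_of_notMem hu] at h
  have h1 : (S ∩ U).card ≤ (S ∩ insert u U).card :=
    Finset.card_le_card (Finset.inter_subset_inter_left (Finset.subset_insert _ _))
  have h2 : (innerD U).card + 1 ≤ (innerD (insert u U)).card := by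
    rw [← Finset.card_insert_of_notMem hd']
    apply Finset.card_le_card
    rintro ⟨i, j⟩ hx
    rw [Finset.mem_insert] at hx
    rcases hx with rfl | hx
    · exact hd
    · rw [mem_innerD] at *
      simp only [Finset.mem_insert]
      tauto
  omega

theorem count_all {n : ℕ} {S : Finset (ℕ × ℕ)} (hS : SpreadOut n S) :
    ∀ (m : ℕ) (U : Finset (ℕ × ℕ)), (upF 0 0 n).card ≤ U.card + m → U ⊆ upF 0 0 n →
      (S ∩ U).card + (innerD U).card ≤ U.card := by
  intro m
  induction m with
  | zero =>
    intro U h hU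
    have hE : U = upF 0 0 n := Finset.eq_of_subset_of_card_le hU h
    apply count_closed hS _ U le_rfl hU
    subst hE
    have := card_up_down 0 0 n
    intro i j
    simp only [mem_upF]
    omega
  | succ m ih =>
    intro U h hU
    by_cases hc : Clo U
    · exact count_closed hS _ U le_rfl hU hc
    have step : ∀ u d : ℕ × ℕ, u ∉ U → u ∈ upF 0 0 n → d ∈ innerD (insert u U) → d ∉ innerD U →
        (S ∩ U).card + (innerD U).card ≤ U.card := by
      intro u d hu hun hd hd'
      apply count_add hu hd hd'
      apply ih
      · rw [Finset.card_insert_of_notMem hu]; omega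
      · exact Finset.insert_subset hun hU
    unfold Clo at hc
    push Not at hc
    obtain ⟨i, j, hc⟩ := hc
    by_cases h1 : (i, j) ∈ U <;> by_cases h2 : (i+1, j) ∈ U <;> by_cases h3 : (i, j+1) ∈ U
    · exact absurd h3 (by tauto)
    · refine step (i, j+1) (i, j) h3 ?_ ?_ ?_
      · have := hU h2; rw [mem_upF] at *; omega
      · rw [mem_innerD]; simp [h1, h2]
      · rw [mem_innerD]; tauto
    · refine step (i+1, j) (i, j) h2 ?_ ?_ ?_
      · have := hU h3; rw [mem_upF] at *; omega
      · rw [mem_innerD]; simp [h1, h3]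
      · rw [mem_innerD]; tauto
    · exfalso; tauto
    · refine step (i, j) (i, j) h1 ?_ ?_ ?_
      · have := hU h3; rw [mem_upF] at *; omega
      · rw [mem_innerD]; simp [h2, h3]
      · rw [mem_innerD]; tauto
    all_goals exfalso; tauto

/-- The neighbours of a downward cell. -/
def nb (d : ℕ × ℕ) : Finset (ℕ × ℕ) := {d, (d.1 + 1, d.2), (d.1, d.2 + 1)}

theorem hall_cond {n : ℕ} {S : Finset (ℕ × ℕ)} (hS : SpreadOut n S)
    (D : Finset (ℕ × ℕ)) (hD : D ⊆ downF 0 0 n) :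
    D.card ≤ (D.biUnion nb \ S).card := by
  have hU : D.biUnion nb ⊆ upF 0 0 n := by
    rintro ⟨x, y⟩ h
    rw [Finset.mem_biUnion] at h
    obtain ⟨⟨i, j⟩, hd, h⟩ := h
    have := hD hd
    rw [mem_downF] at this
    simp only [nb, Finset.mem_insert, Finset.mem_singleton, Prod.mk.injEq] at h
    rw [mem_upF]; omega
  have h := count_all hS _ (D.biUnion nb) (Nat.le_add_left _ _) hU
  have h2 : D.card ≤ (innerD (D.biUnion nb)).card := by
    apply Finset.card_le_card
    rintro ⟨i, j⟩ hd
    rw [mem_innerD]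
    simp only [Finset.mem_biUnion]
    exact ⟨⟨_, hd, by simp [nb]⟩, ⟨_, hd, by simp [nb]⟩, ⟨_, hd, by simp [nb]⟩⟩
  have h3 := Finset.card_sdiff_add_card_inter (D.biUnion nb) S
  rw [Finset.inter_comm] at h3
  omega

theorem adj_iff {d u : ℕ × ℕ} : Adj d u ↔ u ∈ nb d := by
  simp [Adj, nb]

theorem coe_upF (n : ℕ) : (upF 0 0 n : Set (ℕ × ℕ)) = UpTri n := by
  ext ⟨i, j⟩
  rw [Finset.mem_coe, mem_upF]
  simp [UpTri]

theorem coe_downF (n : ℕ) : (downF 0 0 n : Set (ℕ × ℕ)) = DownTri n := by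
  ext ⟨i, j⟩
  rw [Finset.mem_coe, mem_downF]
  simp [DownTri]

/-- For every set `S` of `n` upward unit triangles in Δ, there exists a
fine mixed subdivision of Δ with hole set `S` if and only if `S` is spread-out. -/
theorem exists_tiling_iff_spreadOut (n : ℕ) (hn : 0 < n) (S : Finset (ℕ × ℕ))
    (hS : ↑S ⊆ UpTri n) (hcard : S.card = n) :
    (∃ f : ℕ × ℕ → ℕ × ℕ, IsTiling n ↑S f) ↔ SpreadOut n S := by
  classical
  constructor
  · rintro ⟨f, hf, hadj⟩ a b k hk
    have hcard2 : (downF a b k).card ≤ (upF a b k \ S).card := by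
      have hsub : ∀ d ∈ downF a b k, d ∈ DownTri n := by
        rintro ⟨i, j⟩ h
        rw [mem_downF] at h
        simp only [DownTri, Set.mem_ofPred_eq]; omega
      apply Finset.card_le_card_of_injOn f
      · rintro ⟨i, j⟩ h
        have hd := hsub _ h
        have h1 := hadj _ hd
        have h2 := (hf.mapsTo hd).2
        have h' := mem_downF.1 h
        simp only [Finset.coe_sdiff, Set.mem_sdiff, Finset.mem_coe]
        refine ⟨?_, h2⟩
        rcases h1 with h1 | h1 | h1 <;> rw [h1, mem_upF] <;> omega
      · exact hf.injOn.mono hsub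
    have h3 := Finset.card_sdiff_add_card_inter (upF a b k) S
    have h4 := card_up_down a b k
    have h5 : (S.filter (fun p => a ≤ p.1 ∧ b ≤ p.2 ∧ p.1 + p.2 + 1 ≤ a + b + k)).card ≤
        (upF a b k ∩ S).card := by
      apply Finset.card_le_card
      rintro ⟨i, j⟩ h
      rw [Finset.mem_filter] at h
      rw [Finset.mem_inter, mem_upF]
      exact ⟨h.2, h.1⟩
    omega
  · intro hs
    have hall := (Finset.all_card_le_biUnion_card_iff_exists_injective
      (fun d : {d // d ∈ downF 0 0 n} => nb d.1 \ S)).1 (by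
        intro D
        have h := hall_cond hs (D.map (Function.Embedding.subtype _)) (by
          intro x hx
          rw [Finset.mem_map] at hx
          obtain ⟨y, _, rfl⟩ := hx
          exact y.2)
        rw [Finset.card_map] at h
        refine h.trans (Finset.card_le_card ?_)
        intro u hu
        simp only [Finset.mem_sdiff, Finset.mem_biUnion, Finset.mem_map] at hu ⊢
        obtain ⟨⟨d, ⟨y, hy, rfl⟩, hu⟩, hus⟩ := hu
        exact ⟨y, hy, hu, hus⟩)
    obtain ⟨g, hg, hgn⟩ := hall
    let f : ℕ × ℕ → ℕ × ℕ := fun d => if h : d ∈ downF 0 0 n then g ⟨d, h⟩ else d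
    have hfd : ∀ d (h : d ∈ downF 0 0 n), f d = g ⟨d, h⟩ := fun d h => by simp [f, h]
    have hmaps : ∀ d ∈ downF 0 0 n, f d ∈ upF 0 0 n \ S := by
      rintro ⟨i, j⟩ h
      rw [hfd _ h]
      have h1 := hgn ⟨(i, j), h⟩
      generalize g ⟨(i, j), h⟩ = u at h1
      obtain ⟨x, y⟩ := u
      rw [mem_downF] at h
      simp only [nb, Finset.mem_sdiff, Finset.mem_insert, Finset.mem_singleton,
        Prod.mk.injEq] at h1
      rw [Finset.mem_sdiff, mem_upF]
      exact ⟨by omega, h1.2⟩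
    have hinj : Set.InjOn f (downF 0 0 n) := by
      intro x hx y hy hxy
      rw [hfd x hx, hfd y hy] at hxy
      simpa using hg hxy
    have hSsub : S ⊆ upF 0 0 n := by
      rw [← coe_upF] at hS
      exact_mod_cast hS
    have hc1 := Finset.card_sdiff_add_card_eq_card hSsub
    have hc2 := card_up_down 0 0 n
    have hsurj : Set.SurjOn f (downF 0 0 n) ((upF 0 0 n \ S : Finset (ℕ × ℕ)) : Set (ℕ × ℕ)) :=
      Finset.surjOn_of_injOn_of_card_le f hmaps hinj (by omega)
    refine ⟨f, ?_, ?_⟩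
    · rw [← coe_downF, ← coe_upF, ← Finset.coe_sdiff]
      exact ⟨hmaps, hinj, hsurj⟩
    · intro d hd
      rw [← coe_downF] at hd
      rw [adj_iff, hfd d hd]
      exact (Finset.mem_sdiff.1 (hgn ⟨d, hd⟩)).1
end

section
/- A generalized hole set H admits a tiling of Δ if and only if H is spread-out. -/
/-- For upward subtriangles `s = T(a,b,k)` and `s' = T(a',b',k')` (encoded as triples),
`ctc s s' = min(a+b+k, a'+b'+k') - max(a,a') - max(b,b')`.  The closed triangles meet
iff `ctc s s' ≥ 0`, and touch at exactly one point iff `ctc s s' = 0`. -/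
def ctc (s t : ℕ × ℕ × ℕ) : ℤ :=
  min ((s.1 : ℤ) + s.2.1 + s.2.2) ((t.1 : ℤ) + t.2.1 + t.2.2)
    - max (s.1 : ℤ) (t.1 : ℤ) - max (s.2.1 : ℤ) (t.2.1 : ℤ)

/-- The upward unit triangles covered by some member of the generalized hole set `H`. -/
def holeUpCells (H : Finset (ℕ × ℕ × ℕ)) : Set (ℕ × ℕ) :=
  {p | ∃ s ∈ H, p ∈ UpCells s.1 s.2.1 s.2.2}

/-- The downward unit triangles covered by some member of the generalized hole set `H`. -/
def holeDownCells (H : Finset (ℕ × ℕ × ℕ)) : Set (ℕ × ℕ) :=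
  {p | ∃ s ∈ H, p ∈ DownCells s.1 s.2.1 s.2.2}

/-- `H` is a generalized hole set: a finite set of upward subtriangles of Δ of sizes ≥ 1,
pairwise with `ctc ≤ 0` (disjoint interiors), whose sizes sum to `n`. -/
def IsGenHoleSet (n : ℕ) (H : Finset (ℕ × ℕ × ℕ)) : Prop :=
  (∀ s ∈ H, 1 ≤ s.2.2 ∧ s.1 + s.2.1 + s.2.2 ≤ n) ∧
  (∀ s ∈ H, ∀ t ∈ H, s ≠ t → ctc s t ≤ 0) ∧
  (∑ s ∈ H, s.2.2) = n

/-- A tiling of Δ with generalized hole set `H`: a bijection from the downward unit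
triangles lying in no hole onto the upward unit triangles lying in no hole, sending
each downward triangle to an adjacent upward triangle. -/
def IsGenTiling (n : ℕ) (H : Finset (ℕ × ℕ × ℕ)) (f : ℕ × ℕ → ℕ × ℕ) : Prop :=
  Set.BijOn f (DownTri n \ holeDownCells H) (UpTri n \ holeUpCells H) ∧
  ∀ d ∈ DownTri n \ holeDownCells H, Adj d (f d)

/-- `H` is spread-out: for every upward subtriangle `T(a,b,k)` of Δ,
`Σ_{s ∈ H} max(ctc s T, 0) ≤ k`. -/
def GenSpreadOut (n : ℕ) (H : Finset (ℕ × ℕ × ℕ)) : Prop :=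
  ∀ a b k : ℕ, a + b + k ≤ n → (∑ s ∈ H, max (ctc s (a, b, k)) 0) ≤ (k : ℤ)

/-- Upward cells as a finset. -/
def UpF (a b k : ℕ) : Finset (ℕ × ℕ) :=
  (Finset.range (a + b + k) ×ˢ Finset.range (a + b + k)).filter
    (fun p => a ≤ p.1 ∧ b ≤ p.2 ∧ p.1 + p.2 + 1 ≤ a + b + k)

/-- Downward cells as a finset. -/
def DnF (a b k : ℕ) : Finset (ℕ × ℕ) :=
  (Finset.range (a + b + k) ×ˢ Finset.range (a + b + k)).filter
    (fun p => a ≤ p.1 ∧ b ≤ p.2 ∧ p.1 + p.2 + 2 ≤ a + b + k)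

/-- The outer diagonal of a triangle. -/
def DiagF (a b k : ℕ) : Finset (ℕ × ℕ) :=
  (Finset.range k).image (fun i => (a + i, b + (k - 1 - i)))

theorem mem_UpF {a b k : ℕ} {p : ℕ × ℕ} :
    p ∈ UpF a b k ↔ a ≤ p.1 ∧ b ≤ p.2 ∧ p.1 + p.2 + 1 ≤ a + b + k := by
  simp only [UpF, Finset.mem_filter, Finset.mem_product, Finset.mem_range]
  omega

theorem mem_DnF {a b k : ℕ} {p : ℕ × ℕ} :
    p ∈ DnF a b k ↔ a ≤ p.1 ∧ b ≤ p.2 ∧ p.1 + p.2 + 2 ≤ a + b + k := by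
  simp only [DnF, Finset.mem_filter, Finset.mem_product, Finset.mem_range]
  omega

theorem mem_DiagF {a b k : ℕ} {p : ℕ × ℕ} :
    p ∈ DiagF a b k ↔ a ≤ p.1 ∧ b ≤ p.2 ∧ p.1 + p.2 + 1 = a + b + k := by
  obtain ⟨x, y⟩ := p
  simp only [DiagF, Finset.mem_image, Finset.mem_range, Prod.mk.injEq]
  constructor
  · rintro ⟨i, hi, h1, h2⟩
    omega
  · rintro ⟨h1, h2, h3⟩
    exact ⟨x - a, by omega, by omega, by omega⟩

theorem card_DiagF (a b k : ℕ) : (DiagF a b k).card = k := by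
  unfold DiagF
  rw [Finset.card_image_of_injective, Finset.card_range]
  intro i j h
  simp only [Prod.mk.injEq] at h
  omega

theorem card_UpF (a b k : ℕ) : (UpF a b k).card = (DnF a b k).card + k := by
  have h : UpF a b k = DnF a b k ∪ DiagF a b k := by
    ext p
    rw [Finset.mem_union, mem_UpF, mem_DnF, mem_DiagF]
    omega
  rw [h, Finset.card_union_of_disjoint, card_DiagF]
  rw [Finset.disjoint_left]
  intro p
  rw [mem_DnF, mem_DiagF]
  omega

/-- Downward triangles all of whose neighbours lie in `U`. -/
def dn (U : Finset (ℕ × ℕ)) : Finset (ℕ × ℕ) :=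
  U.filter (fun p => (p.1 + 1, p.2) ∈ U ∧ (p.1, p.2 + 1) ∈ U)

/-- No downward triangle has exactly two neighbours in `U`. -/
def Closed (U : Finset (ℕ × ℕ)) : Prop :=
  ∀ i j : ℕ, ((i, j) ∈ U → (i + 1, j) ∈ U → (i, j + 1) ∈ U) ∧
    ((i, j) ∈ U → (i, j + 1) ∈ U → (i + 1, j) ∈ U) ∧
    ((i + 1, j) ∈ U → (i, j + 1) ∈ U → (i, j) ∈ U)

theorem grow_left {U : Finset (ℕ × ℕ)} (hU : Closed U) {i b k j : ℕ}
    (hT : UpF (i + 1) b k ⊆ U) (h : (i, j) ∈ U) (hb : b ≤ j) (hj : j ≤ b + k) :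
    UpF i b (k + 1) ⊆ U := by
  have up : ∀ t, j + t ≤ b + k → (i, j + t) ∈ U := by
    intro t
    induction t with
    | zero => intro _; exact h
    | succ t ih =>
      intro ht
      exact (hU i (j + t)).1 (ih (by omega)) (hT (mem_UpF.2 (by dsimp only; omega)))
  have down : ∀ t, ∀ y, b ≤ y → y + t = j → (i, y) ∈ U := by
    intro t
    induction t with
    | zero => intro y _ hy; obtain rfl : y = j := by omega
              exact h
    | succ t ih =>
      intro y hy ht
      exact (hU i y).2.2 (hT (mem_UpF.2 (by dsimp only; omega))) (ih (y + 1) (by omega) (by omega))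
  rintro ⟨x, y⟩ hp
  rw [mem_UpF] at hp
  dsimp only at hp
  by_cases hx : x = i
  · subst hx
    rcases le_total j y with h1 | h1
    · have := up (y - j) (by omega)
      rwa [Nat.add_sub_cancel' h1] at this
    · exact down (j - y) y (by omega) (by omega)
  · exact hT (mem_UpF.2 (by dsimp only; omega))

theorem grow_bot {U : Finset (ℕ × ℕ)} (hU : Closed U) {i a k j : ℕ}
    (hT : UpF a (j + 1) k ⊆ U) (h : (i, j) ∈ U) (hb : a ≤ i) (hj : i ≤ a + k) :
    UpF a j (k + 1) ⊆ U := by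
  have up : ∀ t, i + t ≤ a + k → (i + t, j) ∈ U := by
    intro t
    induction t with
    | zero => intro _; exact h
    | succ t ih =>
      intro ht
      exact (hU (i + t) j).2.1 (ih (by omega)) (hT (mem_UpF.2 (by dsimp only; omega)))
  have down : ∀ t, ∀ y, a ≤ y → y + t = i → (y, j) ∈ U := by
    intro t
    induction t with
    | zero => intro y _ hy; obtain rfl : y = i := by omega
              exact h
    | succ t ih =>
      intro y hy ht
      exact (hU y j).2.2 (ih (y + 1) (by omega) (by omega)) (hT (mem_UpF.2 (by dsimp only; omega)))
  rintro ⟨y, x⟩ hp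
  rw [mem_UpF] at hp
  dsimp only at hp
  by_cases hx : x = j
  · subst hx
    rcases le_total i y with h1 | h1
    · have := up (y - i) (by omega)
      rwa [Nat.add_sub_cancel' h1] at this
    · exact down (i - y) y (by omega) (by omega)
  · exact hT (mem_UpF.2 (by dsimp only; omega))

theorem grow_diag {U : Finset (ℕ × ℕ)} (hU : Closed U) {i j a b k : ℕ}
    (hT : UpF a b k ⊆ U) (h : (i, j) ∈ U) (ha : a ≤ i) (hb : b ≤ j) (hj : i + j = a + b + k) :
    UpF a b (k + 1) ⊆ U := by
  have up : ∀ t x y, x = i + t → y + t = j → b ≤ y → (x, y) ∈ U := by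
    intro t
    induction t with
    | zero => intro x y h1 h2 _; obtain rfl : x = i := by omega
              obtain rfl : y = j := by omega
              exact h
    | succ t ih =>
      intro x y h1 h2 h3
      have := (hU (i + t) y).2.1 (hT (mem_UpF.2 (by dsimp only; omega)))
        (ih _ _ rfl (by omega) (by omega))
      rw [h1]; exact this
  have down : ∀ t x y, x + t = i → y = j + t → a ≤ x → (x, y) ∈ U := by
    intro t
    induction t with
    | zero => intro x y h1 h2 _; obtain rfl : x = i := by omega
              obtain rfl : y = j := by omega
              exact h
    | succ t ih =>
      intro x y h1 h2 h3
      have := (hU x (j + t)).1 (hT (mem_UpF.2 (by dsimp only; omega)))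
        (ih _ _ (by omega) rfl (by omega))
      rw [h2]; exact this
  rintro ⟨x, y⟩ hp
  rw [mem_UpF] at hp
  dsimp only at hp
  by_cases hx : x + y = a + b + k
  · rcases le_total i x with h1 | h1
    · exact up (x - i) x y (by omega) (by omega) (by omega)
    · exact down (i - x) x y (by omega) (by omega) (by omega)
  · exact hT (mem_UpF.2 (by dsimp only; omega))

theorem closed_case (n : ℕ) (S : Finset (ℕ × ℕ))
    (hS : ∀ a b k, a + b + k ≤ n → (UpF a b k ∩ S).card ≤ k) :
    ∀ m, ∀ U : Finset (ℕ × ℕ), U.card ≤ m → U ⊆ UpF 0 0 n → Closed U →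
      (U ∩ S).card + (dn U).card ≤ U.card := by
  intro m
  induction m with
  | zero =>
    intro U hm _ _
    have : U = ∅ := Finset.card_eq_zero.1 (by omega)
    subst this
    simp [dn]
  | succ m ih =>
    intro U hm hsub hU
    rcases U.eq_empty_or_nonempty with rfl | ⟨⟨x, y⟩, hxy⟩
    · simp [dn]
    have key : ∃ k, 1 ≤ k ∧ (∃ a b, UpF a b k ⊆ U) ∧ ¬ ∃ a b, UpF a b (k + 1) ⊆ U := by
      by_contra hcon
      have hall : ∀ k, ∃ a b, UpF a b (k + 1) ⊆ U := by
        intro k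
        induction k with
        | zero =>
          refine ⟨x, y, ?_⟩
          rintro ⟨p, q⟩ hp
          rw [mem_UpF] at hp
          dsimp only at hp
          obtain rfl : p = x := by omega
          obtain rfl : q = y := by omega
          exact hxy
        | succ k ihk =>
          by_contra h
          exact hcon ⟨k + 1, by omega, ihk, h⟩
      obtain ⟨a, b, h⟩ := hall n
      have h1 : (a + n, b) ∈ U := h (mem_UpF.2 (by dsimp only; omega))
      have h2 := mem_UpF.1 (hsub h1)
      dsimp only at h2
      omega
    obtain ⟨k, hk, ⟨a, b, hT⟩, hmax⟩ := key
    have habk : a + b + k ≤ n := by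
      have h1 : (a + (k - 1), b) ∈ U := hT (mem_UpF.2 (by dsimp only; omega))
      have h2 := mem_UpF.1 (hsub h1)
      dsimp only at h2
      omega
    have far1 : ∀ i j, (i, j) ∈ U → ¬ (i + 1 = a ∧ b ≤ j ∧ j ≤ b + k) := by
      rintro i j h ⟨rfl, h1, h2⟩
      exact hmax ⟨_, _, grow_left hU hT h h1 h2⟩
    have far2 : ∀ i j, (i, j) ∈ U → ¬ (j + 1 = b ∧ a ≤ i ∧ i ≤ a + k) := by
      rintro i j h ⟨rfl, h1, h2⟩
      exact hmax ⟨_, _, grow_bot hU hT h h1 h2⟩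
    have far3 : ∀ i j, (i, j) ∈ U → ¬ (a ≤ i ∧ b ≤ j ∧ i + j = a + b + k) := by
      rintro i j h ⟨h1, h2, h3⟩
      exact hmax ⟨_, _, grow_diag hU hT h h1 h2 h3⟩
    have h0T : ∀ i j, (i, j) ∈ U → (i + 1, j) ∈ U →
        ((i, j) ∈ UpF a b k ↔ (i + 1, j) ∈ UpF a b k) := by
      intro i j h1 h2
      have A := far1 _ _ h1
      have B := far3 _ _ h2
      have A' := far2 _ _ h1
      have B' := far2 _ _ h2
      simp only [mem_UpF]
      omega
    have h1T : ∀ i j, (i, j) ∈ U → (i, j + 1) ∈ U →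
        ((i, j) ∈ UpF a b k ↔ (i, j + 1) ∈ UpF a b k) := by
      intro i j h1 h2
      have A := far2 _ _ h1
      have B := far3 _ _ h2
      simp only [mem_UpF]
      omega
    have h2T : ∀ i j, (i + 1, j) ∈ U → (i, j + 1) ∈ U →
        ((i + 1, j) ∈ UpF a b k ↔ (i, j + 1) ∈ UpF a b k) := by
      intro i j h1 h2
      have A := far2 _ _ h1
      have B := far1 _ _ h2
      simp only [mem_UpF]
      omega
    have hcl : Closed (U \ UpF a b k) := by
      intro i j
      simp only [Finset.mem_sdiff]
      refine ⟨?_, ?_, ?_⟩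
      · rintro ⟨p1, p2⟩ ⟨q1, q2⟩
        have r := (hU i j).1 p1 q1
        exact ⟨r, fun hr => p2 ((h1T i j p1 r).2 hr)⟩
      · rintro ⟨p1, p2⟩ ⟨q1, q2⟩
        have r := (hU i j).2.1 p1 q1
        exact ⟨r, fun hr => p2 ((h0T i j p1 r).2 hr)⟩
      · rintro ⟨p1, p2⟩ ⟨q1, q2⟩
        have r := (hU i j).2.2 p1 q1
        exact ⟨r, fun hr => p2 ((h0T i j r p1).1 hr)⟩
    have hdn : dn U ⊆ DnF a b k ∪ dn (U \ UpF a b k) := by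
      rintro ⟨i, j⟩ hp
      simp only [dn, Finset.mem_filter, Finset.mem_union, Finset.mem_sdiff] at hp ⊢
      obtain ⟨p, q, r⟩ := hp
      have e1 := h0T i j p q
      have e2 := h1T i j p r
      by_cases hc : (i, j) ∈ UpF a b k
      · left
        have e3 := e1.1 hc
        rw [mem_UpF] at hc e3
        rw [mem_DnF]
        dsimp only at *
        omega
      · right
        exact ⟨⟨p, hc⟩, ⟨q, fun h => hc (e1.2 h)⟩, ⟨r, fun h => hc (e2.2 h)⟩⟩
    have c1 := (Finset.card_le_card hdn).trans (Finset.card_union_le _ _)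
    have c2 := card_UpF a b k
    have c3 := Finset.card_sdiff_add_card_eq_card hT
    have c4 := hS a b k habk
    have c5 : (U ∩ S).card ≤ (UpF a b k ∩ S).card + ((U \ UpF a b k) ∩ S).card := by
      refine (Finset.card_le_card ?_).trans (Finset.card_union_le _ _)
      intro p
      simp only [Finset.mem_inter, Finset.mem_union, Finset.mem_sdiff]
      tauto
    have c6 := ih (U \ UpF a b k) (by omega) (Finset.sdiff_subset.trans hsub) hcl
    omega

theorem insert_step {U S : Finset (ℕ × ℕ)} {u d : ℕ × ℕ} (hu : u ∉ U)
    (hd : d ∈ dn (insert u U)) (hd' : d ∉ dn U)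
    (h : (insert u U ∩ S).card + (dn (insert u U)).card ≤ (insert u U).card) :
    (U ∩ S).card + (dn U).card ≤ U.card := by
  have h1 : (insert d (dn U)).card ≤ (dn (insert u U)).card := by
    apply Finset.card_le_card
    intro p hp
    rcases Finset.mem_insert.1 hp with rfl | hp
    · exact hd
    · simp only [dn, Finset.mem_filter, Finset.mem_insert] at hp ⊢
      tauto
  rw [Finset.card_insert_of_notMem hd'] at h1
  rw [Finset.card_insert_of_notMem hu] at h
  have h2 : (U ∩ S).card ≤ (insert u U ∩ S).card :=
    Finset.card_le_card (Finset.inter_subset_inter_right (Finset.subset_insert _ _))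
  omega

theorem general_case (n : ℕ) (S : Finset (ℕ × ℕ))
    (hS : ∀ a b k, a + b + k ≤ n → (UpF a b k ∩ S).card ≤ k) :
    ∀ m, ∀ U : Finset (ℕ × ℕ), (UpF 0 0 n).card ≤ U.card + m → U ⊆ UpF 0 0 n →
      (U ∩ S).card + (dn U).card ≤ U.card := by
  intro m
  induction m with
  | zero =>
    intro U hm hsub
    have : U = UpF 0 0 n := Finset.eq_of_subset_of_card_le hsub hm
    refine closed_case n S hS _ U le_rfl hsub ?_
    subst this
    intro i j
    simp only [mem_UpF]
    omega
  | succ m ih =>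
    intro U hm hsub
    by_cases hU : Closed U
    · exact closed_case n S hS _ U le_rfl hsub hU
    have step : ∀ u d, u ∉ U → u ∈ UpF 0 0 n → d ∈ dn (insert u U) → d ∉ dn U →
        (U ∩ S).card + (dn U).card ≤ U.card := by
      intro u d h1 h2 h3 h4
      refine insert_step h1 h3 h4 (ih _ ?_ (Finset.insert_subset h2 hsub))
      rw [Finset.card_insert_of_notMem h1]
      omega
    unfold Closed at hU
    push Not at hU
    obtain ⟨i, j, hU⟩ := hU
    by_cases h0 : (i, j) ∈ U <;> by_cases h1 : (i + 1, j) ∈ U <;> by_cases h2 : (i, j + 1) ∈ U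
    all_goals try (exfalso; tauto)
    · refine step (i, j + 1) (i, j) h2 ?_ ?_ ?_
      · have := mem_UpF.1 (hsub h1)
        rw [mem_UpF]; dsimp only at *; omega
      · simp [dn, h0, h1]
      · simp [dn, h2]
    · refine step (i + 1, j) (i, j) h1 ?_ ?_ ?_
      · have := mem_UpF.1 (hsub h2)
        rw [mem_UpF]; dsimp only at *; omega
      · simp [dn, h0, h2]
      · simp [dn, h1]
    · refine step (i, j) (i, j) h0 ?_ ?_ ?_
      · have := mem_UpF.1 (hsub h2)
        rw [mem_UpF]; dsimp only at *; omega
      · simp [dn, h1, h2]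
      · simp [dn, h0]

/-- Hole cells as finsets. -/
def HU (H : Finset (ℕ × ℕ × ℕ)) : Finset (ℕ × ℕ) := H.biUnion (fun s => UpF s.1 s.2.1 s.2.2)
/-- Downward hole cells. -/
def HD (H : Finset (ℕ × ℕ × ℕ)) : Finset (ℕ × ℕ) := H.biUnion (fun s => DnF s.1 s.2.1 s.2.2)
/-- Diagonals of holes. -/
def HS (H : Finset (ℕ × ℕ × ℕ)) : Finset (ℕ × ℕ) := H.biUnion (fun s => DiagF s.1 s.2.1 s.2.2)

theorem UpF_disj {n : ℕ} {H : Finset (ℕ × ℕ × ℕ)} (hH : IsGenHoleSet n H) :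
    (H : Set (ℕ × ℕ × ℕ)).PairwiseDisjoint (fun s => UpF s.1 s.2.1 s.2.2) := by
  intro s hs t ht hst
  have h := hH.2.1 s hs t ht hst
  rw [Function.onFun, Finset.disjoint_left]
  intro p
  simp only [mem_UpF]
  unfold ctc at h
  omega

theorem DnF_sub (a b k : ℕ) : DnF a b k ⊆ UpF a b k := by
  intro p; rw [mem_DnF, mem_UpF]; omega

theorem DiagF_sub (a b k : ℕ) : DiagF a b k ⊆ UpF a b k := by
  intro p; rw [mem_DiagF, mem_UpF]; omega

theorem inter_UpF (a b k : ℕ) (s : ℕ × ℕ × ℕ) : UpF a b k ∩ UpF s.1 s.2.1 s.2.2 =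
    UpF (max s.1 a) (max s.2.1 b) (ctc s (a, b, k)).toNat := by
  ext p
  simp only [Finset.mem_inter, mem_UpF, ctc]
  omega

theorem inter_DnF (a b k : ℕ) (s : ℕ × ℕ × ℕ) : DnF a b k ∩ DnF s.1 s.2.1 s.2.2 =
    DnF (max s.1 a) (max s.2.1 b) (ctc s (a, b, k)).toNat := by
  ext p
  simp only [Finset.mem_inter, mem_DnF, ctc]
  omega

theorem inter_Diag (a b k : ℕ) (s : ℕ × ℕ × ℕ) : UpF a b k ∩ DiagF s.1 s.2.1 s.2.2 ⊆
    DiagF (max s.1 a) (max s.2.1 b) (ctc s (a, b, k)).toNat := by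
  intro p
  simp only [Finset.mem_inter, mem_UpF, mem_DiagF, ctc]
  omega

theorem card_inter_holes {n : ℕ} {H : Finset (ℕ × ℕ × ℕ)} (hH : IsGenHoleSet n H) (a b k : ℕ) :
    (UpF a b k ∩ HU H).card =
      (DnF a b k ∩ HD H).card + ∑ s ∈ H, (ctc s (a, b, k)).toNat := by
  unfold HU HD
  rw [Finset.inter_biUnion, Finset.inter_biUnion, Finset.card_biUnion, Finset.card_biUnion,
    ← Finset.sum_add_distrib]
  · refine Finset.sum_congr rfl fun s _ => ?_
    rw [inter_UpF, inter_DnF, card_UpF]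
  · intro s hs t ht hst
    exact (UpF_disj hH hs ht hst).mono (Finset.inter_subset_right.trans (DnF_sub _ _ _))
      (Finset.inter_subset_right.trans (DnF_sub _ _ _))
  · intro s hs t ht hst
    exact (UpF_disj hH hs ht hst).mono Finset.inter_subset_right Finset.inter_subset_right

theorem card_nonhole {n : ℕ} {H : Finset (ℕ × ℕ × ℕ)} (hH : IsGenHoleSet n H) (a b k : ℕ) :
    (UpF a b k \ HU H).card + ∑ s ∈ H, (ctc s (a, b, k)).toNat =
      (DnF a b k \ HD H).card + k := by
  have h1 := card_inter_holes hH a b k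
  have h2 := card_UpF a b k
  have h3 := Finset.card_sdiff_add_card_inter (UpF a b k) (HU H)
  have h4 := Finset.card_sdiff_add_card_inter (DnF a b k) (HD H)
  omega

theorem sum_max (H : Finset (ℕ × ℕ × ℕ)) (t : ℕ × ℕ × ℕ) :
    ∑ s ∈ H, max (ctc s t) 0 = ((∑ s ∈ H, (ctc s t).toNat : ℕ) : ℤ) := by
  push_cast
  refine Finset.sum_congr rfl fun s _ => ?_
  omega

theorem sum_full {n : ℕ} {H : Finset (ℕ × ℕ × ℕ)} (hH : IsGenHoleSet n H) :
    ∑ s ∈ H, (ctc s (0, 0, n)).toNat = n := by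
  conv_rhs => rw [← hH.2.2]
  refine Finset.sum_congr rfl fun s hs => ?_
  have := hH.1 s hs
  simp only [ctc]
  omega

theorem mem_HU {H : Finset (ℕ × ℕ × ℕ)} {p : ℕ × ℕ} : p ∈ HU H ↔ p ∈ holeUpCells H := by
  simp only [HU, Finset.mem_biUnion, mem_UpF, holeUpCells, UpCells, Set.mem_ofPred_eq]

theorem mem_HD {H : Finset (ℕ × ℕ × ℕ)} {p : ℕ × ℕ} : p ∈ HD H ↔ p ∈ holeDownCells H := by
  simp only [HD, Finset.mem_biUnion, mem_DnF, holeDownCells, DownCells, Set.mem_ofPred_eq]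

theorem coe_up (n : ℕ) (H : Finset (ℕ × ℕ × ℕ)) :
    UpTri n \ holeUpCells H = ((UpF 0 0 n \ HU H : Finset (ℕ × ℕ)) : Set (ℕ × ℕ)) := by
  ext p
  simp [mem_HU, mem_UpF, UpTri]

theorem coe_dn (n : ℕ) (H : Finset (ℕ × ℕ × ℕ)) :
    DownTri n \ holeDownCells H = ((DnF 0 0 n \ HD H : Finset (ℕ × ℕ)) : Set (ℕ × ℕ)) := by
  ext p
  simp [mem_HD, mem_DnF, DownTri]

theorem mem_nb {d u : ℕ × ℕ} : u ∈ nb d ↔ Adj d u := by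
  simp [nb, Adj]

theorem hall {n : ℕ} {H : Finset (ℕ × ℕ × ℕ)} (hH : IsGenHoleSet n H) (hs : GenSpreadOut n H)
    (D : Finset (ℕ × ℕ)) (hD : D ⊆ DnF 0 0 n \ HD H) :
    D.card ≤ (D.biUnion (fun d => nb d \ HU H)).card := by
  have hS : ∀ a b k, a + b + k ≤ n → (UpF a b k ∩ HS H).card ≤ k := by
    intro a b k habk
    have h := hs a b k habk
    rw [sum_max] at h
    have h' : ∑ s ∈ H, (ctc s (a, b, k)).toNat ≤ k := by exact_mod_cast h
    refine le_trans ?_ h'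
    unfold HS
    rw [Finset.inter_biUnion]
    refine Finset.card_biUnion_le.trans (Finset.sum_le_sum fun s _ => ?_)
    exact (Finset.card_le_card (inter_Diag a b k s)).trans (card_DiagF _ _ _).le
  have hSc : (HS H).card = n := by
    unfold HS
    rw [Finset.card_biUnion]
    · simp only [card_DiagF]; exact hH.2.2
    · intro s hs t ht hst
      exact (UpF_disj hH hs ht hst).mono (DiagF_sub _ _ _) (DiagF_sub _ _ _)
  have hSU : HS H ⊆ HU H := Finset.biUnion_mono fun s _ => DiagF_sub _ _ _
  have hUU : HU H ⊆ UpF 0 0 n := by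
    intro p hp
    obtain ⟨s, hs, hp⟩ := Finset.mem_biUnion.1 hp
    have := hH.1 s hs
    rw [mem_UpF] at hp ⊢
    omega
  set W := D.biUnion (fun d => nb d \ HU H) with hW
  have hnb : ∀ d ∈ D, ∀ u ∈ nb d, u ∈ W ∪ HU H := by
    intro d hd u hu
    by_cases h : u ∈ HU H
    · exact Finset.mem_union_right _ h
    · exact Finset.mem_union_left _ (Finset.mem_biUnion.2 ⟨d, hd, Finset.mem_sdiff.2 ⟨hu, h⟩⟩)
  have hWsub : W ∪ HU H ⊆ UpF 0 0 n := by
    refine Finset.union_subset ?_ hUU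
    intro u hu
    obtain ⟨d, hd, hu⟩ := Finset.mem_biUnion.1 hu
    have h1 := mem_DnF.1 (Finset.mem_sdiff.1 (hD hd)).1
    have h2 := mem_nb.1 (Finset.mem_sdiff.1 hu).1
    rw [mem_UpF]
    rcases h2 with rfl | rfl | rfl <;> (try dsimp only) <;> omega
  have key := general_case n (HS H) hS (UpF 0 0 n).card (W ∪ HU H) (by omega) hWsub
  rw [Finset.inter_eq_right.2 (hSU.trans Finset.subset_union_right), hSc] at key
  have hdn : D ∪ HD H ⊆ dn (W ∪ HU H) := by
    intro d hd
    unfold dn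
    rw [Finset.mem_filter]
    rcases Finset.mem_union.1 hd with hd | hd
    · exact ⟨hnb d hd _ (mem_nb.2 (Or.inl rfl)), hnb d hd _ (mem_nb.2 (Or.inr (Or.inl rfl))),
        hnb d hd _ (mem_nb.2 (Or.inr (Or.inr rfl)))⟩
    · obtain ⟨s, hs, hp⟩ := Finset.mem_biUnion.1 hd
      rw [mem_DnF] at hp
      refine ⟨?_, ?_, ?_⟩ <;>
        refine Finset.mem_union_right _ (Finset.mem_biUnion.2 ⟨s, hs, mem_UpF.2 ?_⟩) <;>
        (try dsimp only) <;> omega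
  have hdisj : Disjoint D (HD H) := by
    rw [Finset.disjoint_left]
    intro d hd
    exact (Finset.mem_sdiff.1 (hD hd)).2
  have c1 := Finset.card_le_card hdn
  rw [Finset.card_union_of_disjoint hdisj] at c1
  have c2 := Finset.card_union_le W (HU H)
  have c3 : (HU H).card = (HD H).card + n := by
    unfold HU HD
    rw [Finset.card_biUnion (UpF_disj hH), Finset.card_biUnion]
    · simp only [card_UpF]
      rw [Finset.sum_add_distrib, hH.2.2]
    · intro s hs t ht hst
      exact (UpF_disj hH hs ht hst).mono (DnF_sub _ _ _) (DnF_sub _ _ _)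
  omega

/-- A generalized hole set `H` admits a tiling of Δ if and only if `H`
is spread-out. -/
theorem genHoleSet_exists_tiling_iff_spreadOut (n : ℕ) (hn : 0 < n)
    (H : Finset (ℕ × ℕ × ℕ)) (hH : IsGenHoleSet n H) :
    (∃ f : ℕ × ℕ → ℕ × ℕ, IsGenTiling n H f) ↔ GenSpreadOut n H := by
  unfold IsGenTiling
  rw [coe_up, coe_dn]
  constructor
  · rintro ⟨f, hf, hadj⟩ a b k habk
    rw [sum_max]
    have hsub : DnF a b k \ HD H ⊆ DnF 0 0 n \ HD H := by
      refine Finset.sdiff_subset_sdiff ?_ (Finset.Subset.refl _)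
      intro p; rw [mem_DnF, mem_DnF]; omega
    have hle : (DnF a b k \ HD H).card ≤ (UpF a b k \ HU H).card := by
      refine Finset.card_le_card_of_injOn f ?_ ?_
      · intro d hd
        have hd' := hsub hd
        have h1 := hf.mapsTo hd'
        have h2 := hadj d hd'
        have h3 := mem_DnF.1 (Finset.mem_sdiff.1 hd).1
        refine Finset.mem_sdiff.2 ⟨?_, (Finset.mem_sdiff.1 h1).2⟩
        rw [mem_UpF]
        rcases h2 with h2 | h2 | h2 <;> rw [h2] <;> (try dsimp only) <;> omega
      · exact hf.injOn.mono (by exact_mod_cast hsub)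
    have := card_nonhole hH a b k
    have h' : ∑ s ∈ H, (ctc s (a, b, k)).toNat ≤ k := by omega
    exact_mod_cast h'
  · intro hs
    classical
    have hall' := (Finset.all_card_le_biUnion_card_iff_exists_injective
      (fun d : {d // d ∈ DnF 0 0 n \ HD H} => nb d.1 \ HU H)).1 (by
        intro A
        have h := hall hH hs (A.image Subtype.val) (by
          intro d hd
          obtain ⟨x, _, rfl⟩ := Finset.mem_image.1 hd
          exact x.2)
        rw [Finset.card_image_of_injective _ Subtype.val_injective, Finset.image_biUnion] at h
        exact h)
    obtain ⟨g, hg, hgm⟩ := hall'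
    let f : ℕ × ℕ → ℕ × ℕ := fun d => if h : d ∈ DnF 0 0 n \ HD H then g ⟨d, h⟩ else d
    have hfe : ∀ d (h : d ∈ DnF 0 0 n \ HD H), f d = g ⟨d, h⟩ := fun d h => dif_pos h
    have hadj : ∀ d ∈ DnF 0 0 n \ HD H, Adj d (f d) := by
      intro d hd
      rw [hfe d hd]
      exact mem_nb.1 (Finset.mem_sdiff.1 (hgm ⟨d, hd⟩)).1
    have hmaps : ∀ d ∈ DnF 0 0 n \ HD H, f d ∈ UpF 0 0 n \ HU H := by
      intro d hd
      refine Finset.mem_sdiff.2 ⟨?_, ?_⟩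
      · have h2 := hadj d hd
        have h3 := mem_DnF.1 (Finset.mem_sdiff.1 hd).1
        rw [mem_UpF]
        rcases h2 with h2 | h2 | h2 <;> rw [h2] <;> (try dsimp only) <;> omega
      · rw [hfe d hd]
        exact (Finset.mem_sdiff.1 (hgm ⟨d, hd⟩)).2
    have hinj : Set.InjOn f ((DnF 0 0 n \ HD H : Finset (ℕ × ℕ)) : Set (ℕ × ℕ)) := by
      intro d hd e he h
      rw [hfe d hd, hfe e he] at h
      exact congrArg Subtype.val (hg h)
    have hcard : (UpF 0 0 n \ HU H).card ≤ (DnF 0 0 n \ HD H).card := by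
      have h1 := card_nonhole hH 0 0 n
      rw [sum_full hH] at h1
      omega
    refine ⟨f, ⟨hmaps, hinj, ?_⟩, hadj⟩
    exact Finset.surjOn_of_injOn_of_card_le f hmaps hinj hcard
end

section
/- Let s₁ and s₂ be upward subtriangles of Δ with c(s₁,s₂) = 0 (their closed triangles touch at exactly one point). Then there is exactly one bijection g from the downward unit triangles of s₁ ∨ s₂ lying in neither s₁ nor s₂ onto the upward unit triangles of s₁ ∨ s₂ lying in neither s₁ nor s₂ such that g(d) is adjacent to d for every d; that is, the region (s₁ ∨ s₂) ∖ (s₁ ∪ s₂) has a unique rhombus tiling. -/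
/-- The join `s ∨ s'` of two upward subtriangles: the smallest upward subtriangle
containing both. -/
def tjoin (s t : ℕ × ℕ × ℕ) : ℕ × ℕ × ℕ :=
  (min s.1 t.1, min s.2.1 t.2.1,
    max (s.1 + s.2.1 + s.2.2) (t.1 + t.2.1 + t.2.2) - min s.1 t.1 - min s.2.1 t.2.1)

/-- `g` is a rhombus tiling with downward cells `D` and upward cells `U`. -/
def IsRegionTiling (D U : Set (ℕ × ℕ)) (g : ℕ × ℕ → ℕ × ℕ) : Prop :=
  Set.BijOn g D U ∧ ∀ d ∈ D, Adj d (g d)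

/-- Existence and uniqueness of a rhombus tiling. -/
def UniquelyTileable (D U : Set (ℕ × ℕ)) : Prop :=
  (∃ g, IsRegionTiling D U g) ∧
    ∀ g₁ g₂, IsRegionTiling D U g₁ → IsRegionTiling D U g₂ → Set.EqOn g₁ g₂ D

/-- A tiling is unique as soon as some potential `φ` on upward cells is strictly minimised,
among the neighbours of each downward cell, by that tiling. -/
lemma uniquelyTileable_of_potential (D U : Set (ℕ × ℕ)) (hD : D.Finite)
    (g : ℕ × ℕ → ℕ × ℕ) (φ : ℕ × ℕ → ℤ) (hg : IsRegionTiling D U g)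
    (hφ : ∀ d ∈ D, ∀ u ∈ U, Adj d u → u ≠ g d → φ (g d) < φ u) :
    UniquelyTileable D U := by
  have key : ∀ f, IsRegionTiling D U f → Set.EqOn f g D := by
    intro f hf
    have hle : ∀ d ∈ hD.toFinset, φ (g d) ≤ φ (f d) := by
      intro d hd
      have hd' := hD.mem_toFinset.1 hd
      by_cases h : f d = g d
      · rw [h]
      · exact (hφ d hd' _ (hf.1.mapsTo hd') (hf.2 d hd') h).le
    have hsum : ∑ d ∈ hD.toFinset, φ (g d) = ∑ d ∈ hD.toFinset, φ (f d) := by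
      have e : ∀ h : ℕ × ℕ → ℕ × ℕ, IsRegionTiling D U h →
          ∑ d ∈ hD.toFinset, φ (h d) = ∑ᶠ u ∈ U, φ u := by
        intro h hh
        rw [← hh.1.image_eq, finsum_mem_image hh.1.injOn,
          finsum_mem_eq_finite_toFinset_sum _ hD]
      rw [e g hg, e f hf]
    have heq := (Finset.sum_eq_sum_iff_of_le hle).1 hsum
    intro d hd
    by_contra h
    have h1 := hφ d hd _ (hf.1.mapsTo hd) (hf.2 d hd) h
    have h2 := heq d (hD.mem_toFinset.2 hd)
    omega
  exact ⟨⟨g, hg⟩, fun g₁ g₂ h₁ h₂ d hd => (key g₁ h₁ hd).trans (key g₂ h₂ hd).symm⟩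

lemma downCells_finite (a b k : ℕ) : (DownCells a b k).Finite := by
  apply (Set.finite_Iic ((a + b + k, a + b + k) : ℕ × ℕ)).subset
  rintro ⟨i, j⟩ ⟨h1, h2, h3⟩
  simp only [Set.mem_Iic, Prod.mk_le_mk] at *
  omega

/-- Second form of the criterion, with an explicit inverse `r` of the tiling `g`. -/
lemma uniquelyTileable_of_inverse (D U : Set (ℕ × ℕ)) (hD : D.Finite)
    (g r : ℕ × ℕ → ℕ × ℕ) (φ : ℕ × ℕ → ℤ)
    (hg : ∀ i j, (i, j) ∈ D → g (i, j) ∈ U ∧ Adj (i, j) (g (i, j)) ∧ r (g (i, j)) = (i, j))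
    (hr : ∀ i j, (i, j) ∈ U → r (i, j) ∈ D ∧ g (r (i, j)) = (i, j))
    (h0 : ∀ i j, (i, j) ∈ D → (i, j) ∈ U →
      (i, j) = g (i, j) ∨ φ (g (i, j)) < φ (i, j))
    (h1 : ∀ i j, (i, j) ∈ D → (i + 1, j) ∈ U →
      (i + 1, j) = g (i, j) ∨ φ (g (i, j)) < φ (i + 1, j))
    (h2 : ∀ i j, (i, j) ∈ D → (i, j + 1) ∈ U →
      (i, j + 1) = g (i, j) ∨ φ (g (i, j)) < φ (i, j + 1)) :
    UniquelyTileable D U := by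
  refine uniquelyTileable_of_potential D U hD g φ ⟨⟨?_, ?_, ?_⟩, ?_⟩ ?_
  · rintro ⟨i, j⟩ h
    exact (hg i j h).1
  · rintro ⟨i, j⟩ h ⟨i', j'⟩ h' e
    rw [← (hg i j h).2.2, ← (hg i' j' h').2.2, e]
  · rintro ⟨i, j⟩ h
    exact ⟨_, (hr i j h).1, (hr i j h).2⟩
  · rintro ⟨i, j⟩ h
    exact (hg i j h).2.1
  · rintro ⟨i, j⟩ h u hu (rfl | rfl | rfl) hne
    · exact (h0 i j h hu).resolve_left hne
    · exact (h1 i j h hu).resolve_left hne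
    · exact (h2 i j h hu).resolve_left hne

/-- One triangle is a point of the other. -/
lemma tile_point (a b k a' b' k' p q m : ℕ)
    (h1 : k = 0) (h2 : p = a') (h3 : q = b') (h4 : m = k')
    (h5 : a' ≤ a) (h6 : b' ≤ b) (h7 : a + b ≤ a' + b' + k') :
    UniquelyTileable (DownCells p q m \ (DownCells a b k ∪ DownCells a' b' k'))
      (UpCells p q m \ (UpCells a b k ∪ UpCells a' b' k')) := by
  refine uniquelyTileable_of_inverse _ _ ((downCells_finite p q m).subset Set.sdiff_subset)
    (fun d => d)
    (fun u => u)
    (fun u => (u.1 : ℤ) + u.2) ?_ ?_ ?_ ?_ ?_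
  all_goals
    intro i j
    simp only [DownCells, UpCells, Adj, Set.mem_sdiff, Set.mem_union, Set.mem_ofPred_eq]
    (try split_ifs) <;> (try simp only [Prod.mk.injEq, true_or, or_true, and_true, true_and, implies_true]) <;>
      (try split_ifs) <;> (try simp only [Prod.mk.injEq, true_or, or_true, and_true, true_and, implies_true]) <;>
      (try omega)

/-- The second triangle touches along its side `x = A`. -/
lemma tile_x (a b k a' b' k' p q m A B : ℕ)
    (h1 : a' = A) (h2 : b = B) (h3 : a + k = A) (h4 : b' ≤ B)
    (h5 : A + B ≤ a' + b' + k') (h6 : p = a) (h7 : q = b')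
    (h8 : p + q + m = a' + b' + k') :
    UniquelyTileable (DownCells p q m \ (DownCells a b k ∪ DownCells a' b' k'))
      (UpCells p q m \ (UpCells a b k ∪ UpCells a' b' k')) := by
  refine uniquelyTileable_of_inverse _ _ ((downCells_finite p q m).subset Set.sdiff_subset)
    (fun d => if d.2 < B then (d.1, d.2) else (d.1, d.2 + 1))
    (fun u => if u.2 < B then (u.1, u.2) else (u.1, u.2 - 1))
    (fun u => if u.2 < B then (u.1 : ℤ) + u.2 else - (u.2 : ℤ)) ?_ ?_ ?_ ?_ ?_
  all_goals
    intro i j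
    simp only [DownCells, UpCells, Adj, Set.mem_sdiff, Set.mem_union, Set.mem_ofPred_eq]
    (try split_ifs) <;> (try simp only [Prod.mk.injEq, true_or, or_true, and_true, true_and, implies_true]) <;>
      (try split_ifs) <;> (try simp only [Prod.mk.injEq, true_or, or_true, and_true, true_and, implies_true]) <;>
      (try omega)

/-- The second triangle touches along its side `y = B`. -/
lemma tile_y (a b k a' b' k' p q m A B : ℕ)
    (h1 : b' = B) (h2 : a = A) (h3 : b + k = B) (h4 : a' ≤ A)
    (h5 : A + B ≤ a' + b' + k') (h6 : q = b) (h7 : p = a')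
    (h8 : p + q + m = a' + b' + k') :
    UniquelyTileable (DownCells p q m \ (DownCells a b k ∪ DownCells a' b' k'))
      (UpCells p q m \ (UpCells a b k ∪ UpCells a' b' k')) := by
  refine uniquelyTileable_of_inverse _ _ ((downCells_finite p q m).subset Set.sdiff_subset)
    (fun d => if d.1 < A then (d.1, d.2) else (d.1 + 1, d.2))
    (fun u => if u.1 < A then (u.1, u.2) else (u.1 - 1, u.2))
    (fun u => if u.1 < A then (u.1 : ℤ) + u.2 else - (u.1 : ℤ)) ?_ ?_ ?_ ?_ ?_
  all_goals
    intro i j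
    simp only [DownCells, UpCells, Adj, Set.mem_sdiff, Set.mem_union, Set.mem_ofPred_eq]
    (try split_ifs) <;> (try simp only [Prod.mk.injEq, true_or, or_true, and_true, true_and, implies_true]) <;>
      (try split_ifs) <;> (try simp only [Prod.mk.injEq, true_or, or_true, and_true, true_and, implies_true]) <;>
      (try omega)

/-- The second triangle touches along its side `x + y = A + B`. -/
lemma tile_e (a b k a' b' k' p q m A B : ℕ)
    (h1 : a' + b' + k' = A + B) (h2 : a = A) (h3 : b = B) (h4 : a' ≤ A)
    (h5 : b' ≤ B) (h6 : p = a') (h7 : q = b') (h8 : p + q + m = a + b + k) :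
    UniquelyTileable (DownCells p q m \ (DownCells a b k ∪ DownCells a' b' k'))
      (UpCells p q m \ (UpCells a b k ∪ UpCells a' b' k')) := by
  refine uniquelyTileable_of_inverse _ _ ((downCells_finite p q m).subset Set.sdiff_subset)
    (fun d => if d.1 < A then (d.1, d.2 + 1) else (d.1 + 1, d.2))
    (fun u => if u.1 < A then (u.1, u.2 - 1) else (u.1 - 1, u.2))
    (fun u => if u.1 < A then - (u.2 : ℤ) else - (u.1 : ℤ)) ?_ ?_ ?_ ?_ ?_
  all_goals
    intro i j
    simp only [DownCells, UpCells, Adj, Set.mem_sdiff, Set.mem_union, Set.mem_ofPred_eq]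
    (try split_ifs) <;> (try simp only [Prod.mk.injEq, true_or, or_true, and_true, true_and, implies_true]) <;>
      (try split_ifs) <;> (try simp only [Prod.mk.injEq, true_or, or_true, and_true, true_and, implies_true]) <;>
      (try omega)

/-- If the upward subtriangles `s₁ = T(a,b,k)` and `s₂ = T(a',b',k')`
touch at exactly one point (`ctc s₁ s₂ = 0`), then the region `(s₁ ∨ s₂) \ (s₁ ∪ s₂)`
has a unique rhombus tiling: there is a bijection `g` from its downward unit triangles
onto its upward unit triangles with `g d` adjacent to `d` for every `d`, and any two
such bijections agree on the region. -/
theorem touching_join_unique_tiling (n a b k a' b' k' : ℕ)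
    (h₁ : a + b + k ≤ n) (h₂ : a' + b' + k' ≤ n)
    (hc : ctc (a, b, k) (a', b', k') = 0) :
    (∃ g : ℕ × ℕ → ℕ × ℕ,
        Set.BijOn g
          (DownCells (tjoin (a, b, k) (a', b', k')).1 (tjoin (a, b, k) (a', b', k')).2.1
              (tjoin (a, b, k) (a', b', k')).2.2 \ (DownCells a b k ∪ DownCells a' b' k'))
          (UpCells (tjoin (a, b, k) (a', b', k')).1 (tjoin (a, b, k) (a', b', k')).2.1
              (tjoin (a, b, k) (a', b', k')).2.2 \ (UpCells a b k ∪ UpCells a' b' k')) ∧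
        ∀ d ∈ DownCells (tjoin (a, b, k) (a', b', k')).1 (tjoin (a, b, k) (a', b', k')).2.1
              (tjoin (a, b, k) (a', b', k')).2.2 \ (DownCells a b k ∪ DownCells a' b' k'),
          Adj d (g d)) ∧
    ∀ g₁ g₂ : ℕ × ℕ → ℕ × ℕ,
      (Set.BijOn g₁
          (DownCells (tjoin (a, b, k) (a', b', k')).1 (tjoin (a, b, k) (a', b', k')).2.1
              (tjoin (a, b, k) (a', b', k')).2.2 \ (DownCells a b k ∪ DownCells a' b' k'))
          (UpCells (tjoin (a, b, k) (a', b', k')).1 (tjoin (a, b, k) (a', b', k')).2.1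
              (tjoin (a, b, k) (a', b', k')).2.2 \ (UpCells a b k ∪ UpCells a' b' k')) ∧
        ∀ d ∈ DownCells (tjoin (a, b, k) (a', b', k')).1 (tjoin (a, b, k) (a', b', k')).2.1
              (tjoin (a, b, k) (a', b', k')).2.2 \ (DownCells a b k ∪ DownCells a' b' k'),
          Adj d (g₁ d)) →
      (Set.BijOn g₂
          (DownCells (tjoin (a, b, k) (a', b', k')).1 (tjoin (a, b, k) (a', b', k')).2.1
              (tjoin (a, b, k) (a', b', k')).2.2 \ (DownCells a b k ∪ DownCells a' b' k'))
          (UpCells (tjoin (a, b, k) (a', b', k')).1 (tjoin (a, b, k) (a', b', k')).2.1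
              (tjoin (a, b, k) (a', b', k')).2.2 \ (UpCells a b k ∪ UpCells a' b' k')) ∧
        ∀ d ∈ DownCells (tjoin (a, b, k) (a', b', k')).1 (tjoin (a, b, k) (a', b', k')).2.1
              (tjoin (a, b, k) (a', b', k')).2.2 \ (DownCells a b k ∪ DownCells a' b' k'),
          Adj d (g₂ d)) →
      Set.EqOn g₁ g₂
        (DownCells (tjoin (a, b, k) (a', b', k')).1 (tjoin (a, b, k) (a', b', k')).2.1
            (tjoin (a, b, k) (a', b', k')).2.2 \ (DownCells a b k ∪ DownCells a' b' k')) := by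
  suffices h : UniquelyTileable
      (DownCells (tjoin (a, b, k) (a', b', k')).1 (tjoin (a, b, k) (a', b', k')).2.1
          (tjoin (a, b, k) (a', b', k')).2.2 \ (DownCells a b k ∪ DownCells a' b' k'))
      (UpCells (tjoin (a, b, k) (a', b', k')).1 (tjoin (a, b, k) (a', b', k')).2.1
          (tjoin (a, b, k) (a', b', k')).2.2 \ (UpCells a b k ∪ UpCells a' b' k')) from h
  simp only [ctc] at hc
  simp only [tjoin]
  have swap : ∀ p q m,
      UniquelyTileable (DownCells p q m \ (DownCells a' b' k' ∪ DownCells a b k))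
        (UpCells p q m \ (UpCells a' b' k' ∪ UpCells a b k)) →
      UniquelyTileable (DownCells p q m \ (DownCells a b k ∪ DownCells a' b' k'))
        (UpCells p q m \ (UpCells a b k ∪ UpCells a' b' k')) := by
    intro p q m h
    rwa [Set.union_comm (DownCells a b k), Set.union_comm (UpCells a b k)]
  rcases le_total a a' with ha | ha <;> rcases le_total b b' with hb | hb <;>
    rcases le_total (a + b + k) (a' + b' + k') with he | he
  · apply swap; apply tile_e (A := a') (B := b') <;> omega
  · apply swap; apply tile_point <;> omega
  · apply tile_x (A := a') (B := b) <;> omega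
  · apply swap; apply tile_y (A := a') (B := b) <;> omega
  · apply tile_y (A := a) (B := b') <;> omega
  · apply swap; apply tile_x (A := a) (B := b') <;> omega
  · apply tile_point <;> omega
  · apply tile_e (A := a) (B := b) <;> omega
end

section
/- Call a finite set of upward subtriangles of Δ mergeable if either it equals {T(0,0,n)}, or it contains two elements s₁, s₂ with c(s₁,s₂) = 0 such that the set obtained by replacing s₁ and s₂ with s₁ ∨ s₂ is mergeable (an inductive definition). Then a spread-out set S of n upward unit triangles (each viewed as a subtriangle T(i,j,1) of size 1) admits exactly one fine mixed subdivision of Δ if and only if S is mergeable. -/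
/-- A finite set of upward subtriangles is mergeable if either it is `{T(0,0,n)}`, or it
contains two elements `s₁, s₂` touching at exactly one point (`ctc s₁ s₂ = 0`) such that
replacing them by `s₁ ∨ s₂` yields a mergeable set. -/
inductive Mergeable (n : ℕ) : Finset (ℕ × ℕ × ℕ) → Prop
  | base : Mergeable n {(0, 0, n)}
  | step (S : Finset (ℕ × ℕ × ℕ)) (s₁ s₂ : ℕ × ℕ × ℕ) :
      s₁ ∈ S → s₂ ∈ S → s₁ ≠ s₂ → ctc s₁ s₂ = 0 →
      Mergeable n (insert (tjoin s₁ s₂) ((S.erase s₁).erase s₂)) → Mergeable n S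

set_option linter.unusedSimpArgs false

/-- Holes lying in the triangle `T`. -/
def holesIn (S : Finset (ℕ × ℕ)) (T : ℕ × ℕ × ℕ) : Finset (ℕ × ℕ) :=
  S.filter (fun p => T.1 ≤ p.1 ∧ T.2.1 ≤ p.2 ∧ p.1 + p.2 + 1 ≤ T.1 + T.2.1 + T.2.2)

/-- `T` is a nonempty saturated subtriangle. -/
def Satd (n : ℕ) (S : Finset (ℕ × ℕ)) (T : ℕ × ℕ × ℕ) : Prop :=
  1 ≤ T.2.2 ∧ T.1 + T.2.1 + T.2.2 ≤ n ∧ T.2.2 ≤ (holesIn S T).card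

/-- The region `D`, `U` has a tiling which every global tiling must restrict to. -/
def Rigid (n : ℕ) (S : Set (ℕ × ℕ)) (D U : Set (ℕ × ℕ)) : Prop :=
  ∃ g : ℕ × ℕ → ℕ × ℕ, Set.BijOn g D (U \ S) ∧ (∀ d ∈ D, Adj d (g d)) ∧
    ∀ f, IsTiling n S f → Set.EqOn f g D

/-- Rigidity of a subtriangle. -/
def RigidT (n : ℕ) (S : Finset (ℕ × ℕ)) (T : ℕ × ℕ × ℕ) : Prop :=
  Rigid n ↑S (DownCells T.1 T.2.1 T.2.2) (UpCells T.1 T.2.1 T.2.2)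

theorem rigid_glue (n : ℕ) (S D1 D2 DJ U1 U2 UJ : Set (ℕ × ℕ))
    (r : ℕ × ℕ → ℕ × ℕ) (rk : ℕ × ℕ → ℕ)
    (hDJ : DJ ⊆ DownTri n)
    (hD1 : D1 ⊆ DJ) (hD2 : D2 ⊆ DJ) (hU1 : U1 ⊆ UJ) (hU2 : U2 ⊆ UJ)
    (hUd : ∀ u ∈ U1, u ∉ U2) (hDd : ∀ d ∈ D1, d ∉ D2)
    (hS : ∀ u ∈ UJ, u ∈ S → u ∈ U1 ∨ u ∈ U2)
    (hr : ∀ d ∈ DJ, d ∉ D1 → d ∉ D2 → Adj d (r d) ∧ r d ∈ UJ ∧ r d ∉ U1 ∧ r d ∉ U2)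
    (hinj : ∀ d ∈ DJ, d ∉ D1 → d ∉ D2 → ∀ d' ∈ DJ, d' ∉ D1 → d' ∉ D2 → r d = r d' → d = d')
    (hsurj : ∀ u ∈ UJ, u ∉ U1 → u ∉ U2 → ∃ d ∈ DJ, d ∉ D1 ∧ d ∉ D2 ∧ r d = u)
    (hforce : ∀ d ∈ DJ, d ∉ D1 → d ∉ D2 → ∀ u, Adj d u → u = r d ∨ u ∈ U1 ∨ u ∈ U2 ∨
      ∃ d' ∈ DJ, d' ∉ D1 ∧ d' ∉ D2 ∧ r d' = u ∧ rk d' < rk d)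
    (h1 : Rigid n S D1 U1) (h2 : Rigid n S D2 U2) : Rigid n S DJ UJ := by
  classical
  obtain ⟨g1, ⟨m1, i1, s1⟩, a1, e1⟩ := h1
  obtain ⟨g2, ⟨m2, i2, s2⟩, a2, e2⟩ := h2
  let g : ℕ × ℕ → ℕ × ℕ := fun d => if d ∈ D1 then g1 d else if d ∈ D2 then g2 d else r d
  have hg1 : ∀ d ∈ D1, g d = g1 d := fun d hd => by simp [g, hd]
  have hg2 : ∀ d ∈ D2, g d = g2 d := fun d hd => by
    have : d ∉ D1 := fun h => hDd d h hd
    simp [g, hd, this]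
  have hg3 : ∀ d, d ∉ D1 → d ∉ D2 → g d = r d := fun d h h' => by simp [g, h, h']
  refine ⟨g, ⟨?_, ?_, ?_⟩, ?_, ?_⟩
  · intro d hd
    by_cases c1 : d ∈ D1
    · rw [hg1 d c1]; exact ⟨hU1 (m1 c1).1, (m1 c1).2⟩
    by_cases c2 : d ∈ D2
    · rw [hg2 d c2]; exact ⟨hU2 (m2 c2).1, (m2 c2).2⟩
    rw [hg3 d c1 c2]
    obtain ⟨_, b1, b2, b3⟩ := hr d hd c1 c2
    exact ⟨b1, fun h => (hS _ b1 h).elim b2 b3⟩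
  · have key : ∀ d ∈ DJ, (d ∈ D1 ∧ g d = g1 d ∧ g d ∈ U1 ∧ g d ∉ U2) ∨
        (d ∈ D2 ∧ g d = g2 d ∧ g d ∈ U2 ∧ g d ∉ U1) ∨
        (d ∉ D1 ∧ d ∉ D2 ∧ g d = r d ∧ g d ∉ U1 ∧ g d ∉ U2) := by
      intro d hd
      by_cases c1 : d ∈ D1
      · left
        rw [hg1 d c1]; exact ⟨c1, rfl, (m1 c1).1, hUd _ (m1 c1).1⟩
      by_cases c2 : d ∈ D2
      · right; left
        rw [hg2 d c2]; exact ⟨c2, rfl, (m2 c2).1, fun h => hUd _ h (m2 c2).1⟩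
      right; right
      rw [hg3 d c1 c2]
      obtain ⟨_, b1, b2, b3⟩ := hr d hd c1 c2
      exact ⟨c1, c2, rfl, b2, b3⟩
    intro d hd d' hd' h
    rcases key d hd with ⟨p1, p2, p3, p4⟩ | ⟨p1, p2, p3, p4⟩ | ⟨p1, p2, p3, p4, p5⟩ <;>
    rcases key d' hd' with ⟨q1, q2, q3, q4⟩ | ⟨q1, q2, q3, q4⟩ | ⟨q1, q2, q3, q4, q5⟩
    · exact i1 p1 q1 (by rw [← p2, ← q2, h])
    · exact absurd (h ▸ p3) q4
    · exact absurd (h ▸ p3) q4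
    · exact absurd (h ▸ p3) q4
    · exact i2 p1 q1 (by rw [← p2, ← q2, h])
    · exact absurd (h ▸ p3) q5
    · exact absurd (h ▸ q3) p4
    · exact absurd (h ▸ q3) p5
    · exact hinj d hd p1 p2 d' hd' q1 q2 (by rw [← p3, ← q3, h])
  · rintro u ⟨hu, huS⟩
    by_cases c1 : u ∈ U1
    · obtain ⟨d, hd, rfl⟩ := s1 ⟨c1, huS⟩
      exact ⟨d, hD1 hd, hg1 d hd⟩
    by_cases c2 : u ∈ U2
    · obtain ⟨d, hd, rfl⟩ := s2 ⟨c2, huS⟩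
      exact ⟨d, hD2 hd, hg2 d hd⟩
    obtain ⟨d, hd, x1, x2, rfl⟩ := hsurj u hu c1 c2
    exact ⟨d, hd, hg3 d x1 x2⟩
  · intro d hd
    by_cases c1 : d ∈ D1
    · rw [hg1 d c1]; exact a1 d c1
    by_cases c2 : d ∈ D2
    · rw [hg2 d c2]; exact a2 d c2
    rw [hg3 d c1 c2]
    exact (hr d hd c1 c2).1
  · intro f hf
    have main : ∀ N, ∀ d ∈ DJ, d ∉ D1 → d ∉ D2 → rk d = N → f d = r d := by
      intro N
      induction N using Nat.strong_induction_on with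
      | _ N ih =>
        intro d hd c1 c2 hN
        have hfd := hf.1.mapsTo (hDJ hd)
        rcases hforce d hd c1 c2 (f d) (hf.2 d (hDJ hd)) with h | h | h | ⟨d', hd', x1, x2, x3, x4⟩
        · exact h
        · obtain ⟨d', hd', h'⟩ := s1 ⟨h, hfd.2⟩
          rw [← e1 f hf hd'] at h'
          exact absurd (hf.1.injOn (hDJ (hD1 hd')) (hDJ hd) h' ▸ hd') c1
        · obtain ⟨d', hd', h'⟩ := s2 ⟨h, hfd.2⟩
          rw [← e2 f hf hd'] at h'
          exact absurd (hf.1.injOn (hDJ (hD2 hd')) (hDJ hd) h' ▸ hd') c2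
        · have := ih (rk d') (hN ▸ x4) d' hd' x1 x2 rfl
          rw [x3] at this
          have := hf.1.injOn (hDJ hd') (hDJ hd) this
          subst this
          omega
    intro d hd
    by_cases c1 : d ∈ D1
    · rw [hg1 d c1]; exact e1 f hf c1
    by_cases c2 : d ∈ D2
    · rw [hg2 d c2]; exact e2 f hf c2
    rw [hg3 d c1 c2]
    exact main _ d hd c1 c2 rfl

theorem ctc_comm (s t : ℕ × ℕ × ℕ) : ctc s t = ctc t s := by
  unfold ctc
  omega

theorem tjoin_comm (s t : ℕ × ℕ × ℕ) : tjoin s t = tjoin t s := by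
  unfold tjoin
  rw [min_comm s.1, min_comm s.2.1, max_comm]

theorem sat_disjoint {n : ℕ} {S : Finset (ℕ × ℕ)} (hsp : SpreadOut n S) {s t : ℕ × ℕ × ℕ}
    (hs : Satd n S s) (ht : Satd n S t) (hd : Disjoint (holesIn S s) (holesIn S t)) :
    ctc s t ≤ 0 ∧ (ctc s t = 0 → Satd n S (tjoin s t) ∧
      holesIn S (tjoin s t) = holesIn S s ∪ holesIn S t) := by
  obtain ⟨a, b, k⟩ := s
  obtain ⟨a', b', k'⟩ := t
  obtain ⟨h1, h2, h3⟩ := hs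
  obtain ⟨g1, g2, g3⟩ := ht
  have hsub : holesIn S (a, b, k) ∪ holesIn S (a', b', k') ⊆
      holesIn S (tjoin (a, b, k) (a', b', k')) := by
    intro p hp
    rw [Finset.mem_union] at hp
    simp only [holesIn, Finset.mem_filter] at hp
    rcases hp with ⟨h, hp⟩ | ⟨h, hp⟩ <;> refine Finset.mem_filter.2 ⟨h, ?_⟩ <;>
      simp only [tjoin] <;> omega
  have hc := Finset.card_le_card hsub
  rw [Finset.card_union_of_disjoint hd] at hc
  have hle : (holesIn S (tjoin (a, b, k) (a', b', k'))).card ≤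
      (tjoin (a, b, k) (a', b', k')).2.2 := by
    apply hsp
    simp only [tjoin] at *
    omega
  have hsz : ((tjoin (a, b, k) (a', b', k')).2.2 : ℤ) + ctc (a, b, k) (a', b', k') = k + k' := by
    simp only [tjoin, ctc] at *
    omega
  simp only at h1 h2 h3 g1 g2 g3
  refine ⟨by omega, fun h0 => ⟨⟨by omega, ?_, by omega⟩, ?_⟩⟩
  · simp only [tjoin]
    omega
  · symm
    apply Finset.eq_of_subset_of_card_le hsub
    rw [Finset.card_union_of_disjoint hd]
    omega

theorem disjoint_of_ctc {S : Finset (ℕ × ℕ)} {s t : ℕ × ℕ × ℕ} (h : ctc s t ≤ 0) :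
    Disjoint (holesIn S s) (holesIn S t) := by
  rw [Finset.disjoint_left]
  intro p hp hq
  simp only [holesIn, Finset.mem_filter, ctc] at *
  omega

/-- The lower-left corner of `s` lies on the hypotenuse of `t`. -/
theorem mergeA {n : ℕ} {S : Finset (ℕ × ℕ)} {a b k a' b' k' : ℕ}
    (ha : a' ≤ a) (hb : b' ≤ b) (ht : a' + b' + k' = a + b) (hk : 1 ≤ k) (hk' : 1 ≤ k')
    (hn : a + b + k ≤ n)
    (hS : ∀ p ∈ UpCells a' b' (k + k'), p ∈ (S : Set (ℕ × ℕ)) →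
      p ∈ UpCells a b k ∨ p ∈ UpCells a' b' k')
    (h1 : RigidT n S (a, b, k)) (h2 : RigidT n S (a', b', k')) :
    RigidT n S (a', b', k + k') := by
  refine rigid_glue n S _ _ _ _ _ _ (fun d => if d.1 < a then (d.1, d.2 + 1) else (d.1 + 1, d.2))
    (fun d => if d.1 < a then d.2 else d.1) ?_ ?_ ?_ ?_ ?_ ?_ ?_ hS ?_ ?_ ?_ ?_ h1 h2
  all_goals simp only [Set.subset_def, Prod.forall, DownCells, UpCells, DownTri, Set.mem_ofPred_eq]
  · intros; omega
  · intros; omega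
  · intros; omega
  · intros; omega
  · intros; omega
  · intros; omega
  · intros; omega
  · intro x y h c1 c2
    split_ifs with h'
    · refine ⟨Or.inr (Or.inr rfl), ?_⟩
      simp only []
      omega
    · refine ⟨Or.inr (Or.inl rfl), ?_⟩
      simp only []
      omega
  · intro x y h c1 c2 x' y' h' c1' c2'
    split_ifs <;> simp only [Prod.mk.injEq] <;> omega
  · intro x y h c1 c2
    by_cases hx : x < a
    · refine ⟨(x, y - 1), ?_, ?_, ?_, ?_⟩
      all_goals simp only [hx, if_true, Prod.mk.injEq, true_and, and_true]
      all_goals omega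
    · refine ⟨(x - 1, y), ?_, ?_, ?_, ?_⟩
      rotate_right
      · rw [if_neg (by simp only []; omega), Prod.mk.injEq]
        simp only [true_and, and_true]
        omega
      all_goals simp only []
      all_goals omega
  · intro x y h c1 c2 u v hu
    simp only [Adj, Prod.mk.injEq] at hu
    by_cases hx : x < a
    · simp only [hx, if_true, Prod.mk.injEq, true_and, and_true]
      by_cases e1 : u = x ∧ v = y + 1
      · exact Or.inl e1
      by_cases e2 : (a ≤ u ∧ b ≤ v ∧ u + v + 1 ≤ a + b + k)
      · exact Or.inr (Or.inl e2)
      by_cases e3 : (a' ≤ u ∧ b' ≤ v ∧ u + v + 1 ≤ a' + b' + k')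
      · exact Or.inr (Or.inr (Or.inl e3))
      refine Or.inr (Or.inr (Or.inr ⟨(u, v - 1), ?_⟩))
      have : u < a := by omega
      simp only [this, if_true, Prod.mk.injEq, true_and, and_true]
      omega
    · simp only [hx, if_false, Prod.mk.injEq, true_and, and_true]
      by_cases e1 : u = x + 1 ∧ v = y
      · exact Or.inl e1
      by_cases e2 : (a ≤ u ∧ b ≤ v ∧ u + v + 1 ≤ a + b + k)
      · exact Or.inr (Or.inl e2)
      by_cases e3 : (a' ≤ u ∧ b' ≤ v ∧ u + v + 1 ≤ a' + b' + k')
      · exact Or.inr (Or.inr (Or.inl e3))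
      refine Or.inr (Or.inr (Or.inr ⟨(u - 1, v), ?_⟩))
      have : ¬ (u - 1 < a) := by omega
      simp only [this, if_false, Prod.mk.injEq, true_and, and_true]
      omega

/-- The `j`-top corner of `s` lies on the bottom edge of `t`. -/
theorem mergeB {n : ℕ} {S : Finset (ℕ × ℕ)} {a b k a' b' k' : ℕ}
    (ha : a' ≤ a) (hb : b' = b + k) (ht : a + b + k ≤ a' + b' + k') (hk : 1 ≤ k) (hk' : 1 ≤ k')
    (hn : a' + b' + k' ≤ n)
    (hS : ∀ p ∈ UpCells a' b (k + k'), p ∈ (S : Set (ℕ × ℕ)) →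
      p ∈ UpCells a b k ∨ p ∈ UpCells a' b' k')
    (h1 : RigidT n S (a, b, k)) (h2 : RigidT n S (a', b', k')) :
    RigidT n S (a', b, k + k') := by
  refine rigid_glue n S _ _ _ _ _ _ (fun d => if d.1 < a then (d.1, d.2) else (d.1 + 1, d.2))
    (fun d => if d.1 < a then n - d.1 - d.2 else n + d.1) ?_ ?_ ?_ ?_ ?_ ?_ ?_ hS ?_ ?_ ?_ ?_ h1 h2
  all_goals simp only [Set.subset_def, Prod.forall, DownCells, UpCells, DownTri, Set.mem_ofPred_eq]
  · intros; omega
  · intros; omega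
  · intros; omega
  · intros; omega
  · intros; omega
  · intros; omega
  · intros; omega
  · intro x y h c1 c2
    split_ifs with h'
    · refine ⟨Or.inl rfl, ?_⟩
      simp only []
      omega
    · refine ⟨Or.inr (Or.inl rfl), ?_⟩
      simp only []
      omega
  · intro x y h c1 c2 x' y' h' c1' c2'
    split_ifs <;> simp only [Prod.mk.injEq] <;> omega
  · intro x y h c1 c2
    by_cases hx : x < a
    · refine ⟨(x, y), ?_, ?_, ?_, ?_⟩
      all_goals simp only [hx, if_true, true_and, and_true]
      all_goals omega
    · refine ⟨(x - 1, y), ?_, ?_, ?_, ?_⟩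
      rotate_right
      · rw [if_neg (by simp only []; omega), Prod.mk.injEq]
        simp only [true_and, and_true]
        omega
      all_goals simp only []
      all_goals omega
  · intro x y h c1 c2 u v hu
    simp only [Adj, Prod.mk.injEq] at hu
    by_cases hx : x < a
    · simp only [hx, if_true, Prod.mk.injEq, true_and, and_true]
      by_cases e1 : u = x ∧ v = y
      · exact Or.inl e1
      by_cases e2 : (a ≤ u ∧ b ≤ v ∧ u + v + 1 ≤ a + b + k)
      · exact Or.inr (Or.inl e2)
      by_cases e3 : (a' ≤ u ∧ b' ≤ v ∧ u + v + 1 ≤ a' + b' + k')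
      · exact Or.inr (Or.inr (Or.inl e3))
      refine Or.inr (Or.inr (Or.inr ⟨(u, v), ?_⟩))
      have : u < a := by omega
      simp only [this, if_true, true_and, and_true]
      omega
    · simp only [hx, if_false, Prod.mk.injEq, true_and, and_true]
      by_cases e1 : u = x + 1 ∧ v = y
      · exact Or.inl e1
      by_cases e2 : (a ≤ u ∧ b ≤ v ∧ u + v + 1 ≤ a + b + k)
      · exact Or.inr (Or.inl e2)
      by_cases e3 : (a' ≤ u ∧ b' ≤ v ∧ u + v + 1 ≤ a' + b' + k')
      · exact Or.inr (Or.inr (Or.inl e3))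
      refine Or.inr (Or.inr (Or.inr ⟨(u - 1, v), ?_⟩))
      have : ¬ (u - 1 < a) := by omega
      simp only [this, if_false, Prod.mk.injEq, true_and, and_true]
      omega

/-- The `i`-right corner of `s` lies on the left edge of `t`. -/
theorem mergeC {n : ℕ} {S : Finset (ℕ × ℕ)} {a b k a' b' k' : ℕ}
    (hb : b' ≤ b) (ha : a' = a + k) (ht : a + b + k ≤ a' + b' + k') (hk : 1 ≤ k) (hk' : 1 ≤ k')
    (hn : a' + b' + k' ≤ n)
    (hS : ∀ p ∈ UpCells a b' (k + k'), p ∈ (S : Set (ℕ × ℕ)) →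
      p ∈ UpCells a b k ∨ p ∈ UpCells a' b' k')
    (h1 : RigidT n S (a, b, k)) (h2 : RigidT n S (a', b', k')) :
    RigidT n S (a, b', k + k') := by
  refine rigid_glue n S _ _ _ _ _ _ (fun d => if d.2 < b then (d.1, d.2) else (d.1, d.2 + 1))
    (fun d => if d.2 < b then n - d.1 - d.2 else n + d.2) ?_ ?_ ?_ ?_ ?_ ?_ ?_ hS ?_ ?_ ?_ ?_ h1 h2
  all_goals simp only [Set.subset_def, Prod.forall, DownCells, UpCells, DownTri, Set.mem_ofPred_eq]
  · intros; omega
  · intros; omega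
  · intros; omega
  · intros; omega
  · intros; omega
  · intros; omega
  · intros; omega
  · intro x y h c1 c2
    split_ifs with h'
    · refine ⟨Or.inl rfl, ?_⟩
      simp only []
      omega
    · refine ⟨Or.inr (Or.inr rfl), ?_⟩
      simp only []
      omega
  · intro x y h c1 c2 x' y' h' c1' c2'
    split_ifs <;> simp only [Prod.mk.injEq] <;> omega
  · intro x y h c1 c2
    by_cases hx : y < b
    · refine ⟨(x, y), ?_, ?_, ?_, ?_⟩
      all_goals simp only [hx, if_true, true_and, and_true]
      all_goals omega
    · refine ⟨(x, y - 1), ?_, ?_, ?_, ?_⟩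
      rotate_right
      · rw [if_neg (by simp only []; omega), Prod.mk.injEq]
        simp only [true_and, and_true]
        omega
      all_goals simp only []
      all_goals omega
  · intro x y h c1 c2 u v hu
    simp only [Adj, Prod.mk.injEq] at hu
    by_cases hx : y < b
    · simp only [hx, if_true, Prod.mk.injEq, true_and, and_true]
      by_cases e1 : u = x ∧ v = y
      · exact Or.inl e1
      by_cases e2 : (a ≤ u ∧ b ≤ v ∧ u + v + 1 ≤ a + b + k)
      · exact Or.inr (Or.inl e2)
      by_cases e3 : (a' ≤ u ∧ b' ≤ v ∧ u + v + 1 ≤ a' + b' + k')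
      · exact Or.inr (Or.inr (Or.inl e3))
      refine Or.inr (Or.inr (Or.inr ⟨(u, v), ?_⟩))
      have : v < b := by omega
      simp only [this, if_true, true_and, and_true]
      omega
    · simp only [hx, if_false, Prod.mk.injEq, true_and, and_true]
      by_cases e1 : u = x ∧ v = y + 1
      · exact Or.inl e1
      by_cases e2 : (a ≤ u ∧ b ≤ v ∧ u + v + 1 ≤ a + b + k)
      · exact Or.inr (Or.inl e2)
      by_cases e3 : (a' ≤ u ∧ b' ≤ v ∧ u + v + 1 ≤ a' + b' + k')
      · exact Or.inr (Or.inr (Or.inl e3))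
      refine Or.inr (Or.inr (Or.inr ⟨(u, v - 1), ?_⟩))
      have : ¬ (v - 1 < b) := by omega
      simp only [this, if_false, Prod.mk.injEq, true_and, and_true]
      omega

theorem merge_oriented {n : ℕ} {S : Finset (ℕ × ℕ)} {s t : ℕ × ℕ × ℕ}
    (hs : Satd n S s) (ht : Satd n S t) (h0 : ctc s t = 0)
    (hH : holesIn S (tjoin s t) = holesIn S s ∪ holesIn S t)
    (h1 : RigidT n S s) (h2 : RigidT n S t)
    (hor : (t.1 ≤ s.1 ∧ t.2.1 ≤ s.2.1 ∧ t.1 + t.2.1 + t.2.2 ≤ s.1 + s.2.1 + s.2.2) ∨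
      (t.1 ≤ s.1 ∧ s.2.1 ≤ t.2.1 ∧ s.1 + s.2.1 + s.2.2 ≤ t.1 + t.2.1 + t.2.2) ∨
      (s.1 ≤ t.1 ∧ t.2.1 ≤ s.2.1 ∧ s.1 + s.2.1 + s.2.2 ≤ t.1 + t.2.1 + t.2.2)) :
    RigidT n S (tjoin s t) := by
  obtain ⟨a, b, k⟩ := s
  obtain ⟨a', b', k'⟩ := t
  obtain ⟨p1, p2, -⟩ := hs
  obtain ⟨q1, q2, -⟩ := ht
  have hS : ∀ p ∈ UpCells (tjoin (a, b, k) (a', b', k')).1 (tjoin (a, b, k) (a', b', k')).2.1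
      (tjoin (a, b, k) (a', b', k')).2.2, p ∈ (S : Set (ℕ × ℕ)) →
      p ∈ UpCells a b k ∨ p ∈ UpCells a' b' k' := by
    intro p hp hpS
    have : p ∈ holesIn S (tjoin (a, b, k) (a', b', k')) := Finset.mem_filter.2 ⟨hpS, hp⟩
    rw [hH, Finset.mem_union] at this
    simp only [holesIn, Finset.mem_filter] at this
    exact this.imp (fun h => h.2) (fun h => h.2)
  simp only [ctc] at p1 p2 q1 q2 h0 hor
  rcases hor with ⟨o1, o2, o3⟩ | ⟨o1, o2, o3⟩ | ⟨o1, o2, o3⟩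
  · have e : tjoin (a, b, k) (a', b', k') = (a', b', k + k') := by
      simp only [tjoin, Prod.mk.injEq, true_and, and_true]
      omega
    rw [e] at hS ⊢
    exact mergeA o1 o2 (by omega) p1 q1 p2 hS h1 h2
  · have e : tjoin (a, b, k) (a', b', k') = (a', b, k + k') := by
      simp only [tjoin, Prod.mk.injEq, true_and, and_true]
      omega
    rw [e] at hS ⊢
    exact mergeB o1 (by omega) o3 p1 q1 q2 hS h1 h2
  · have e : tjoin (a, b, k) (a', b', k') = (a, b', k + k') := by
      simp only [tjoin, Prod.mk.injEq, true_and, and_true]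
      omega
    rw [e] at hS ⊢
    exact mergeC o2 (by omega) o3 p1 q1 q2 hS h1 h2

theorem merge_rigid {n : ℕ} {S : Finset (ℕ × ℕ)} (hsp : SpreadOut n S) {s t : ℕ × ℕ × ℕ}
    (hs : Satd n S s) (ht : Satd n S t) (h0 : ctc s t = 0)
    (h1 : RigidT n S s) (h2 : RigidT n S t) :
    Satd n S (tjoin s t) ∧ RigidT n S (tjoin s t) ∧
      holesIn S (tjoin s t) = holesIn S s ∪ holesIn S t := by
  obtain ⟨hJ, hH⟩ := (sat_disjoint hsp hs ht (disjoint_of_ctc h0.le)).2 h0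
  refine ⟨hJ, ?_, hH⟩
  have h0' := ctc_comm s t ▸ h0
  have hH' : holesIn S (tjoin t s) = holesIn S t ∪ holesIn S s := by
    rw [tjoin_comm, hH, Finset.union_comm]
  have hA := merge_oriented hs ht h0 hH h1 h2
  have hB := merge_oriented ht hs h0' hH' h2 h1
  rw [tjoin_comm] at hB
  by_contra hcon
  have hA' := mt hA hcon
  have hB' := mt hB hcon
  obtain ⟨p1, p2, -⟩ := hs
  obtain ⟨q1, q2, -⟩ := ht
  simp only [ctc] at h0
  omega

theorem mergeable_rigid {n : ℕ} {S : Finset (ℕ × ℕ)} (hsp : SpreadOut n S)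
    {M : Finset (ℕ × ℕ × ℕ)} (hM : Mergeable n M) :
    (∀ T ∈ M, Satd n S T ∧ RigidT n S T) → RigidT n S (0, 0, n) := by
  induction hM with
  | base => intro h; exact (h _ (Finset.mem_singleton_self _)).2
  | step M s t hs ht hne h0 _ ih =>
    intro h
    apply ih
    intro T hT
    rw [Finset.mem_insert] at hT
    rcases hT with rfl | hT
    · obtain ⟨x, y, _⟩ := merge_rigid hsp (h s hs).1 (h t ht).1 h0 (h s hs).2 (h t ht).2
      exact ⟨x, y⟩
    · exact h T (Finset.mem_of_mem_erase (Finset.mem_of_mem_erase hT))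

/-- If every cell of a nonempty finite set of down cells has an alternative, we get a second
tiling. -/
theorem second_tiling {n : ℕ} {S : Set (ℕ × ℕ)} {f : ℕ × ℕ → ℕ × ℕ} (hf : IsTiling n S f)
    (D : Set (ℕ × ℕ)) (hD : D ⊆ DownTri n) (hne : D.Nonempty)
    (halt : ∀ d ∈ D, ∃ d' ∈ D, d' ≠ d ∧ Adj d (f d')) :
    ∃ g, IsTiling n S g ∧ ¬ Set.EqOn f g (DownTri n) := by
  classical
  have hfin : D.Finite := by
    apply Set.Finite.subset _ hD
    apply Set.Finite.subset ((Set.finite_Iic n).prod (Set.finite_Iic n))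
    rintro ⟨x, y⟩ h
    simp only [DownTri, Set.mem_ofPred_eq, Set.mem_prod, Set.mem_Iic] at *
    omega
  have halt' : ∀ d, ∃ d', (d ∈ D → d' ∈ D ∧ d' ≠ d ∧ Adj d (f d')) ∧ (d ∉ D → d' = d) := by
    intro d
    by_cases h : d ∈ D
    · obtain ⟨d', x, y⟩ := halt d h
      exact ⟨d', fun _ => ⟨x, y⟩, fun h' => absurd h h'⟩
    · exact ⟨d, fun h' => absurd h' h, fun _ => rfl⟩
  choose φ hφ1 hφ2 using halt'
  let C := Function.periodicPts φ
  have hC : Set.BijOn φ C C := Function.bijOn_periodicPts φ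
  let σ : ℕ × ℕ → ℕ × ℕ := fun d => if d ∈ C then φ d else d
  have hσ1 : ∀ d ∈ C, σ d = φ d := fun d h => by simp only [σ, if_pos h]
  have hσ2 : ∀ d, d ∉ C → σ d = d := fun d h => by simp only [σ, if_neg h]
  have hφD : ∀ d ∈ DownTri n, φ d ∈ DownTri n := by
    intro d hd
    by_cases h : d ∈ D
    · exact hD (hφ1 d h).1
    · rw [hφ2 d h]; exact hd
  have hσ : Set.BijOn σ (DownTri n) (DownTri n) := by
    refine ⟨?_, ?_, ?_⟩
    · intro d hd
      by_cases h : d ∈ C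
      · rw [hσ1 d h]; exact hφD d hd
      · rw [hσ2 d h]; exact hd
    · intro d _ d' _ h
      by_cases c : d ∈ C <;> by_cases c' : d' ∈ C
      · rw [hσ1 d c, hσ1 d' c'] at h
        exact hC.injOn c c' h
      · rw [hσ1 d c, hσ2 d' c'] at h
        exact absurd (h ▸ hC.mapsTo c) c'
      · rw [hσ2 d c, hσ1 d' c'] at h
        exact absurd (h ▸ hC.mapsTo c') c
      · rw [hσ2 d c, hσ2 d' c'] at h
        exact h
    · intro y hy
      by_cases c : y ∈ C
      · obtain ⟨x, hx, rfl⟩ := hC.surjOn c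
        refine ⟨x, ?_, hσ1 x hx⟩
        by_cases h : x ∈ D
        · exact hD h
        · rwa [hφ2 x h] at hy
      · exact ⟨y, hy, hσ2 y c⟩
  -- a periodic point in D
  obtain ⟨d0, hd0⟩ := hne
  have hit : ∀ m, φ^[m] d0 ∈ D := by
    intro m
    induction m with
    | zero => exact hd0
    | succ m ih => rw [Function.iterate_succ_apply']; exact (hφ1 _ ih).1
  have := hfin.to_subtype
  obtain ⟨p, q, hpq, heq⟩ := Finite.exists_ne_map_eq_of_infinite
    (fun m : ℕ => (⟨φ^[m] d0, hit m⟩ : D))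
  simp only [Subtype.mk.injEq] at heq
  have hper : ∃ m, φ^[m] d0 ∈ C := by
    have aux : ∀ p q : ℕ, p < q → φ^[p] d0 = φ^[q] d0 → φ^[p] d0 ∈ C := by
      intro p q hlt h
      refine Function.mk_mem_periodicPts (n := q - p) (by omega) ?_
      rw [Function.IsPeriodicPt, Function.IsFixedPt, ← Function.iterate_add_apply]
      rw [show q - p + p = q by omega, h]
    rcases lt_or_gt_of_ne hpq with h | h
    · exact ⟨p, aux p q h heq⟩
    · exact ⟨q, aux q p h heq.symm⟩
  obtain ⟨m, hm⟩ := hper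
  refine ⟨f ∘ σ, ⟨hf.1.comp hσ, ?_⟩, ?_⟩
  · intro d hd
    by_cases c : d ∈ C
    · simp only [Function.comp, hσ1 d c]
      by_cases h : d ∈ D
      · exact (hφ1 d h).2.2
      · rw [hφ2 d h]; exact hf.2 d hd
    · simp only [Function.comp, hσ2 d c]
      exact hf.2 d hd
  · intro h
    have hd := hit m
    have h' := h (hD hd)
    simp only [Function.comp, hσ1 _ hm] at h'
    exact (hφ1 _ hd).2.1 (hf.1.injOn (hD hd) (hφD _ (hD hd)) h').symm

theorem rigid_closed {n : ℕ} {S : Finset (ℕ × ℕ)} {f : ℕ × ℕ → ℕ × ℕ} (hf : IsTiling n ↑S f)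
    {T : ℕ × ℕ × ℕ} (hT : Satd n S T) (h : RigidT n S T) {d : ℕ × ℕ} (hd : d ∈ DownTri n)
    (hfd : f d ∈ UpCells T.1 T.2.1 T.2.2) : d ∈ DownCells T.1 T.2.1 T.2.2 := by
  obtain ⟨g, hg, _, he⟩ := h
  obtain ⟨d', hd', h'⟩ := hg.surjOn ⟨hfd, (hf.1.mapsTo hd).2⟩
  rw [← he f hf hd'] at h'
  have : d' ∈ DownTri n := by
    have := hT.2.1
    simp only [DownTri, DownCells, Set.mem_ofPred_eq] at *
    omega
  rwa [← hf.1.injOn this hd h']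

theorem stuck {n : ℕ} {S : Finset (ℕ × ℕ)} {f : ℕ × ℕ → ℕ × ℕ}
    (hf : IsTiling n ↑S f) {M : Finset (ℕ × ℕ × ℕ)}
    (hg : ∀ T ∈ M, Satd n S T ∧ RigidT n S T)
    (hcov : ∀ p ∈ S, ∃ T ∈ M, p ∈ UpCells T.1 T.2.1 T.2.2)
    (hneg : ∀ s ∈ M, ∀ t ∈ M, s ≠ t → ctc s t < 0)
    {T0 : ℕ × ℕ × ℕ} (hT0 : T0 ∈ M) (hne : T0 ≠ (0, 0, n)) :
    ∃ g, IsTiling n ↑S g ∧ ¬ Set.EqOn f g (DownTri n) := by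
  -- two up cells adjacent to an outer down cell cannot both be covered
  have hcell : ∀ d u v : ℕ × ℕ, Adj d u → Adj d v → u ≠ v →
      (∀ T ∈ M, d ∉ DownCells T.1 T.2.1 T.2.2) →
      ∀ s ∈ M, ∀ t ∈ M, u ∈ UpCells s.1 s.2.1 s.2.2 → v ∈ UpCells t.1 t.2.1 t.2.2 → False := by
    rintro ⟨x, y⟩ ⟨u1, u2⟩ ⟨v1, v2⟩ hu hv huv hout s hs t ht hus hvt
    simp only [Adj, Prod.mk.injEq] at hu hv
    have huv' : ¬ (u1 = v1 ∧ u2 = v2) := fun h => huv (by rw [h.1, h.2])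
    by_cases hst : s = t
    · subst hst
      apply hout s hs
      simp only [UpCells, DownCells, Set.mem_ofPred_eq] at *
      omega
    · have := hneg s hs t ht hst
      simp only [ctc, UpCells, Set.mem_ofPred_eq] at *
      omega
  refine second_tiling hf {d | d ∈ DownTri n ∧ ∀ T ∈ M, d ∉ DownCells T.1 T.2.1 T.2.2}
    (fun d h => h.1) ?_ ?_
  · -- nonempty
    have key : ∃ d u, d ∈ DownTri n ∧ Adj d u ∧ u ∈ UpCells T0.1 T0.2.1 T0.2.2 ∧
        d ∉ DownCells T0.1 T0.2.1 T0.2.2 := by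
      obtain ⟨a, b, k⟩ := T0
      obtain ⟨⟨h1, h2, -⟩, -⟩ := hg _ hT0
      simp only [ne_eq, Prod.mk.injEq] at h1 h2 hne
      by_cases ha : 0 < a
      · refine ⟨(a - 1, b), (a, b), ?_, Or.inr (Or.inl ?_), ?_, ?_⟩ <;>
          simp only [UpCells, DownCells, DownTri, Set.mem_ofPred_eq, Prod.mk.injEq, true_and, and_true] <;> omega
      by_cases hb : 0 < b
      · refine ⟨(a, b - 1), (a, b), ?_, Or.inr (Or.inr ?_), ?_, ?_⟩ <;>
          simp only [UpCells, DownCells, DownTri, Set.mem_ofPred_eq, Prod.mk.injEq, true_and, and_true] <;> omega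
      · refine ⟨(k - 1, 0), (k - 1, 0), ?_, Or.inl rfl, ?_, ?_⟩ <;>
          simp only [UpCells, DownCells, DownTri, Set.mem_ofPred_eq] <;> omega
    obtain ⟨d, u, hd, hu, huT, hdT⟩ := key
    refine ⟨d, hd, fun T hT hdT' => ?_⟩
    by_cases h : T0 = T
    · exact hdT (h ▸ hdT')
    · have := hneg T0 hT0 T hT h
      obtain ⟨x, y⟩ := d
      obtain ⟨u1, u2⟩ := u
      simp only [ctc, Adj, UpCells, DownCells, Set.mem_ofPred_eq, Prod.mk.injEq] at *
      omega
  · rintro d ⟨hd, hout⟩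
    have hnb : ∀ u, Adj d u → (∀ T ∈ M, u ∉ UpCells T.1 T.2.1 T.2.2) → u ≠ f d →
        ∃ d' ∈ {d | d ∈ DownTri n ∧ ∀ T ∈ M, d ∉ DownCells T.1 T.2.1 T.2.2},
          d' ≠ d ∧ Adj d (f d') := by
      intro u hu hunc hufd
      have huU : u ∈ UpTri n \ (S : Set (ℕ × ℕ)) := by
        refine ⟨?_, fun h => ?_⟩
        · obtain ⟨x, y⟩ := d
          obtain ⟨u1, u2⟩ := u
          simp only [Adj, UpTri, DownTri, Set.mem_ofPred_eq, Prod.mk.injEq] at *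
          omega
        · obtain ⟨T, hT, h'⟩ := hcov u h
          exact hunc T hT h'
      obtain ⟨d', hd', rfl⟩ := hf.1.surjOn huU
      refine ⟨d', ⟨hd', fun T hT h => ?_⟩, ?_, hu⟩
      · apply hunc T hT
        have h2 := hf.2 d' hd'
        revert h2
        generalize f d' = u
        intro h2
        obtain ⟨x, y⟩ := d'
        obtain ⟨u1, u2⟩ := u
        simp only [Adj, UpCells, DownCells, Set.mem_ofPred_eq, Prod.mk.injEq] at h h2 ⊢
        omega
      · rintro rfl
        exact hufd rfl
    have htwo : ∃ u v, Adj d u ∧ Adj d v ∧ u ≠ v ∧ u ≠ f d ∧ v ≠ f d := by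
      have h0 : d ≠ (d.1 + 1, d.2) := fun h => by
        have := congrArg Prod.fst h
        simp at this
      have h1 : d ≠ (d.1, d.2 + 1) := fun h => by
        have := congrArg Prod.snd h
        simp at this
      have h2 : (d.1 + 1, d.2) ≠ (d.1, d.2 + 1) := fun h => by
        have := congrArg Prod.fst h
        simp at this
      rcases hf.2 d hd with h | h | h <;> rw [h]
      · exact ⟨_, _, Or.inr (Or.inl rfl), Or.inr (Or.inr rfl), h2, h0.symm, h1.symm⟩
      · exact ⟨_, _, Or.inl rfl, Or.inr (Or.inr rfl), h1, h0, h2.symm⟩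
      · exact ⟨_, _, Or.inl rfl, Or.inr (Or.inl rfl), h0, h1, h2⟩
    obtain ⟨u, v, hu, hv, huv, huf, hvf⟩ := htwo
    by_cases cu : ∀ T ∈ M, u ∉ UpCells T.1 T.2.1 T.2.2
    · exact hnb u hu cu huf
    by_cases cv : ∀ T ∈ M, v ∉ UpCells T.1 T.2.1 T.2.2
    · exact hnb v hv cv hvf
    push Not at cu cv
    obtain ⟨s, hs, hs'⟩ := cu
    obtain ⟨t, ht, ht'⟩ := cv
    exact (hcell d u v hu hv huv hout s hs t ht hs' ht').elim

theorem mergeable_of_unique {n : ℕ} {S : Finset (ℕ × ℕ)} (hsp : SpreadOut n S)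
    {f : ℕ × ℕ → ℕ × ℕ} (hf : IsTiling n ↑S f)
    (huniq : ∀ g, IsTiling n ↑S g → Set.EqOn f g (DownTri n)) :
    ∀ (N : ℕ) (M : Finset (ℕ × ℕ × ℕ)), M.card = N → M.Nonempty →
    (∀ T ∈ M, Satd n S T ∧ RigidT n S T) →
    (∀ p ∈ S, ∃ T ∈ M, p ∈ UpCells T.1 T.2.1 T.2.2) →
    (∀ s ∈ M, ∀ t ∈ M, s ≠ t → Disjoint (holesIn S s) (holesIn S t)) → Mergeable n M := by
  intro N
  induction N with
  | zero =>
    intro M h0 hne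
    rw [Finset.card_eq_zero] at h0
    exact absurd h0 hne.ne_empty
  | succ N ih =>
    intro M hN hne hg hcov hdis
    by_cases hex : ∃ s ∈ M, ∃ t ∈ M, s ≠ t ∧ ctc s t = 0
    · obtain ⟨s, hs, t, ht, hst, h0⟩ := hex
      obtain ⟨hJ, hJr, hJh⟩ := merge_rigid hsp (hg s hs).1 (hg t ht).1 h0 (hg s hs).2 (hg t ht).2
      have hJdis : ∀ T ∈ (M.erase s).erase t,
          Disjoint (holesIn S (tjoin s t)) (holesIn S T) := by
        intro T hT
        rw [Finset.mem_erase, Finset.mem_erase] at hT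
        rw [hJh, Finset.disjoint_union_left]
        exact ⟨hdis s hs T hT.2.2 (Ne.symm hT.2.1), hdis t ht T hT.2.2 (Ne.symm hT.1)⟩
      have hsub : ∀ T ∈ (M.erase s).erase t, T ∈ M := fun T hT =>
        Finset.mem_of_mem_erase (Finset.mem_of_mem_erase hT)
      refine Mergeable.step M s t hs ht hst h0 (ih _ ?_ (Finset.insert_nonempty _ _) ?_ ?_ ?_)
      · rw [Finset.card_insert_of_notMem, Finset.card_erase_of_mem, Finset.card_erase_of_mem hs]
        · have : 1 < M.card := Finset.one_lt_card.2 ⟨s, hs, t, ht, hst⟩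
          omega
        · exact Finset.mem_erase.2 ⟨hst.symm, ht⟩
        · intro h
          have := hJdis _ h
          rw [disjoint_self, Finset.bot_eq_empty, ← Finset.card_eq_zero] at this
          have h1 := hJ.1
          have h2 := hJ.2.2
          omega
      · intro T hT
        rw [Finset.mem_insert] at hT
        rcases hT with rfl | hT
        · exact ⟨hJ, hJr⟩
        · exact hg T (hsub T hT)
      · intro p hp
        obtain ⟨T, hT, hpT⟩ := hcov p hp
        have hpH : p ∈ holesIn S T := Finset.mem_filter.2 ⟨hp, hpT⟩
        by_cases hTs : T = s ∨ T = t
        · refine ⟨tjoin s t, Finset.mem_insert_self _ _, ?_⟩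
          have : p ∈ holesIn S (tjoin s t) := by
            rw [hJh, Finset.mem_union]
            rcases hTs with rfl | rfl
            · exact Or.inl hpH
            · exact Or.inr hpH
          exact (Finset.mem_filter.1 this).2
        · push Not at hTs
          exact ⟨T, Finset.mem_insert_of_mem
            (Finset.mem_erase.2 ⟨hTs.2, Finset.mem_erase.2 ⟨hTs.1, hT⟩⟩), hpT⟩
      · intro s' hs' t' ht' hne'
        rw [Finset.mem_insert] at hs' ht'
        rcases hs' with rfl | hs' <;> rcases ht' with rfl | ht'
        · exact absurd rfl hne'
        · exact hJdis t' ht'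
        · exact (hJdis s' hs').symm
        · exact hdis s' (hsub _ hs') t' (hsub _ ht') hne'
    · push Not at hex
      by_cases hall : ∀ T ∈ M, T = (0, 0, n)
      · have : M = {(0, 0, n)} := Finset.eq_singleton_iff_nonempty_unique_mem.2 ⟨hne, hall⟩
        rw [this]
        exact Mergeable.base
      · push Not at hall
        obtain ⟨T0, hT0, hT0n⟩ := hall
        obtain ⟨g, hg', hgne⟩ := stuck hf hg hcov (fun s hs t ht hst =>
          lt_of_le_of_ne (sat_disjoint hsp (hg s hs).1 (hg t ht).1 (hdis s hs t ht hst)).1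
            (hex s hs t ht hst)) hT0 hT0n
        exact absurd (huniq g hg') hgne

theorem unit_holes {S : Finset (ℕ × ℕ)} {p : ℕ × ℕ} (hp : p ∈ S) :
    holesIn S (p.1, p.2, 1) = {p} := by
  obtain ⟨x, y⟩ := p
  ext ⟨u, v⟩
  simp only [holesIn, Finset.mem_filter, Finset.mem_singleton, Prod.mk.injEq, true_and, and_true]
  constructor
  · rintro ⟨_, h⟩
    omega
  · rintro ⟨rfl, rfl⟩
    exact ⟨hp, by omega⟩

theorem unit_good {n : ℕ} {S : Finset (ℕ × ℕ)} (hS : ↑S ⊆ UpTri n) {p : ℕ × ℕ} (hp : p ∈ S) :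
    Satd n S (p.1, p.2, 1) ∧ RigidT n S (p.1, p.2, 1) := by
  have hpU : p ∈ UpTri n := hS hp
  refine ⟨⟨le_refl _, hpU, by rw [unit_holes hp]; simp⟩, ?_⟩
  have hD : DownCells p.1 p.2 1 = ∅ := by
    ext u
    simp only [DownCells, Set.mem_ofPred_eq, Set.mem_empty_iff_false, iff_false]
    omega
  have hU : UpCells p.1 p.2 1 \ (S : Set (ℕ × ℕ)) = ∅ := by
    ext u
    simp only [Set.mem_empty_iff_false, iff_false]
    rintro ⟨h1, h2⟩
    have : u ∈ UpCells p.1 p.2 1 → u = p := by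
      simp only [UpCells, Set.mem_ofPred_eq]
      intro h
      apply Prod.ext <;> omega
    exact h2 (this h1 ▸ hp)
  refine ⟨id, ?_, ?_, ?_⟩
  · simp only [hD, hU]
    exact Set.bijOn_empty id
  · simp only [hD]
    simp
  · simp only [hD]
    simp

/-- A spread-out set `S` of `n` upward unit triangles (viewed as
subtriangles of size 1) admits exactly one fine mixed subdivision of Δ if and only if
`S` is mergeable. -/
theorem unique_tiling_iff_mergeable (n : ℕ) (hn : 0 < n) (S : Finset (ℕ × ℕ))
    (hS : ↑S ⊆ UpTri n) (hcard : S.card = n) (hspread : SpreadOut n S) :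
    ((∃ f : ℕ × ℕ → ℕ × ℕ, IsTiling n ↑S f) ∧
      ∀ f g : ℕ × ℕ → ℕ × ℕ, IsTiling n ↑S f → IsTiling n ↑S g →
        Set.EqOn f g (DownTri n)) ↔
    Mergeable n (S.image (fun p => (p.1, p.2, 1))) := by
  constructor
  · rintro ⟨⟨f, hf⟩, huniq⟩
    refine mergeable_of_unique hspread hf (fun g hg => huniq f g hf hg) _ _ rfl ?_ ?_ ?_ ?_
    · rw [Finset.image_nonempty, ← Finset.card_pos]
      omega
    · intro T hT
      obtain ⟨p, hp, rfl⟩ := Finset.mem_image.1 hT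
      exact unit_good hS hp
    · intro p hp
      refine ⟨(p.1, p.2, 1), Finset.mem_image_of_mem _ hp, ?_⟩
      simp only [UpCells, Set.mem_ofPred_eq]
      omega
    · intro s hs t ht hst
      obtain ⟨p, hp, rfl⟩ := Finset.mem_image.1 hs
      obtain ⟨q, hq, rfl⟩ := Finset.mem_image.1 ht
      rw [unit_holes hp, unit_holes hq, Finset.disjoint_singleton]
      rintro rfl
      exact hst rfl
  · intro hM
    have hR : RigidT n S (0, 0, n) := by
      refine mergeable_rigid hspread hM ?_
      intro T hT
      obtain ⟨p, hp, rfl⟩ := Finset.mem_image.1 hT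
      exact unit_good hS hp
    obtain ⟨g, hg, ha, he⟩ := hR
    have hD : DownCells 0 0 n = DownTri n := by
      ext u
      simp only [DownCells, DownTri, Set.mem_ofPred_eq]
      omega
    have hU : UpCells 0 0 n = UpTri n := by
      ext u
      simp only [UpCells, UpTri, Set.mem_ofPred_eq]
      omega
    simp only [hD, hU] at hg ha he
    refine ⟨⟨g, hg, ha⟩, fun f f' hf hf' d hd => ?_⟩
    rw [he f hf hd, he f' hf' hd]
end

section
/- Let f be a tiling of Δ with hole set S, and let d ≠ d′ be downward unit triangles such that f(d) is adjacent to d′ (so d → d′ is an edge of the rhombus graph of f). Then there exists a tiling g of Δ with the same hole set S satisfying g(d′) = f(d) if and only if there is a directed path from d′ to d in the rhombus graph of f. -/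
/-- The rhombus graph of a tiling `f`: an edge `d → d'` whenever `d ≠ d'` are downward
unit triangles and the upward triangle `f d` is adjacent to `d'`. -/
def RhEdge (n : ℕ) (f : ℕ × ℕ → ℕ × ℕ) (d d' : ℕ × ℕ) : Prop :=
  d ∈ DownTri n ∧ d' ∈ DownTri n ∧ d ≠ d' ∧ Adj d' (f d)

theorem downTri_finite (n : ℕ) : (DownTri n).Finite := by
  apply ((Set.finite_Iic n).prod (Set.finite_Iic n)).subset
  rintro ⟨a, b⟩ h
  simp only [DownTri, Set.mem_ofPred_eq] at h
  simp only [Set.mem_prod, Set.mem_Iic]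
  omega

theorem exists_nodup_chain {α : Type*} {r : α → α → Prop} {a b : α}
    (h : Relation.ReflTransGen r a b) :
    ∃ l : List α, (a :: l).IsChain r ∧ (a :: l).Nodup ∧ (a :: l).getLast (by simp) = b := by
  induction h using Relation.ReflTransGen.head_induction_on with
  | refl => exact ⟨[], by simp⟩
  | @head a c hac _ ih =>
    obtain ⟨l, h1, h2, h3⟩ := ih
    by_cases ha : a ∈ c :: l
    · obtain ⟨s, t, hst⟩ := List.append_of_mem ha
      refine ⟨t, ?_, ?_, ?_⟩
      · rw [hst] at h1
        exact h1.right_of_append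
      · rw [hst] at h2
        exact h2.of_append_right
      · rw [← h3]
        simp only [hst]
        rw [List.getLast_append_of_ne_nil]
    · exact ⟨c :: l, List.IsChain.cons_cons hac h1, List.nodup_cons.2 ⟨ha, h2⟩, by simpa using h3⟩

/-- Let `f` be a tiling with hole set `S` and let `d ≠ d'` be downward
unit triangles with `f d` adjacent to `d'` (so `d → d'` is an edge of the rhombus graph).
Then there is a tiling `g` with the same hole set `S` and `g d' = f d` if and only if
there is a directed path from `d'` to `d` in the rhombus graph of `f`. -/
theorem flip_rhombus_iff_reachable (n : ℕ) (hn : 0 < n) (S : Finset (ℕ × ℕ))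
    (hS : ↑S ⊆ UpTri n) (hcard : S.card = n)
    (f : ℕ × ℕ → ℕ × ℕ) (hf : IsTiling n ↑S f)
    (d d' : ℕ × ℕ) (hd : d ∈ DownTri n) (hd' : d' ∈ DownTri n) (hne : d ≠ d')
    (hadj : Adj d' (f d)) :
    (∃ g : ℕ × ℕ → ℕ × ℕ, IsTiling n ↑S g ∧ g d' = f d) ↔
      Relation.ReflTransGen (RhEdge n f) d' d := by
  obtain ⟨hfb, hfa⟩ := hf
  constructor
  · rintro ⟨g, ⟨hgb, hga⟩, hgd⟩
    have hex : ∀ x, ∃ y, x ∈ DownTri n → y ∈ DownTri n ∧ g y = f x := by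
      intro x
      by_cases hx : x ∈ DownTri n
      · obtain ⟨y, hy, h⟩ := hgb.surjOn (hfb.mapsTo hx)
        exact ⟨y, fun _ => ⟨hy, h⟩⟩
      · exact ⟨x, fun h => absurd h hx⟩
    choose σ hσ using hex
    let R : Set (ℕ × ℕ) := {x | x ∈ DownTri n ∧ Relation.ReflTransGen (RhEdge n f) d' x}
    have hRf : R.Finite := (downTri_finite n).subset fun x hx => hx.1
    have hmaps : Set.MapsTo σ R R := by
      rintro x ⟨hx, hr⟩
      obtain ⟨h1, h2⟩ := hσ x hx
      refine ⟨h1, ?_⟩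
      by_cases he : x = σ x
      · rwa [← he]
      · exact hr.tail ⟨hx, h1, he, h2 ▸ hga _ h1⟩
    have hinj : Set.InjOn σ R := by
      rintro x ⟨hx, _⟩ y ⟨hy, _⟩ hxy
      apply hfb.injOn hx hy
      rw [← (hσ x hx).2, ← (hσ y hy).2, hxy]
    have hbij := (hRf.injOn_iff_bijOn_of_mapsTo hmaps).1 hinj
    obtain ⟨x, ⟨hx, hr⟩, hxd⟩ := hbij.surjOn (show d' ∈ R from ⟨hd', .refl⟩)
    have h2 := (hσ x hx).2
    rw [hxd, hgd] at h2
    rwa [hfb.injOn hd hx h2]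
  · intro h
    obtain ⟨l, hc, hnd, hlast⟩ := exists_nodup_chain h
    rw [List.getLast_eq_getElem] at hlast
    obtain ⟨L, hL⟩ : ∃ L, L = d' :: l := ⟨_, rfl⟩
    simp only [← hL] at hc hnd hlast
    have hL0 : 0 < L.length := by simp [hL]
    have hhead : L[0] = d' := by simp [hL]
    have hlast' : L[L.length - 1] = d := hlast
    have key : ∀ y ∈ DownTri n, L.formPerm y ∈ DownTri n ∧ Adj (L.formPerm y) (f y) := by
      intro y hy
      by_cases hyL : y ∈ L
      · obtain ⟨i, hi, rfl⟩ := List.getElem_of_mem hyL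
        by_cases hi' : i + 1 < L.length
        · rw [List.formPerm_apply_lt_getElem _ hnd _ hi']
          have := List.isChain_iff_getElem.1 hc i hi'
          exact ⟨this.2.1, this.2.2.2⟩
        · have hi2 : i = L.length - 1 := by omega
          subst hi2
          have : L.formPerm L[L.length - 1] = d' := by
            rw [List.formPerm_apply_getElem _ hnd]
            rw [← hhead]
            congr 1
            rw [Nat.sub_add_cancel hL0, Nat.mod_self]
          rw [this, hlast']
          exact ⟨hd', hadj⟩
      · rw [List.formPerm_apply_of_notMem hyL]
        exact ⟨hy, hfa y hy⟩
    have hlastp : L.formPerm d = d' := by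
      have : L.formPerm L[L.length - 1] = d' := by
        rw [List.formPerm_apply_getElem _ hnd]
        rw [← hhead]
        congr 1
        rw [Nat.sub_add_cancel hL0, Nat.mod_self]
      rwa [hlast'] at this
    have hbij : Set.BijOn L.formPerm (DownTri n) (DownTri n) :=
      ((downTri_finite n).injOn_iff_bijOn_of_mapsTo (fun y hy => (key y hy).1)).1
        L.formPerm.injective.injOn
    have hbij' : Set.BijOn L.formPerm.symm (DownTri n) (DownTri n) :=
      Set.BijOn.symm ⟨fun x _ => by simp, fun x _ => by simp⟩ hbij
    refine ⟨f ∘ L.formPerm.symm, ⟨hfb.comp hbij', ?_⟩, ?_⟩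
    · intro x hx
      have := (key _ (hbij'.mapsTo hx)).2
      simpa using this
    · simp [← hlastp]
end

section
/- A tiling f of Δ with hole set S is the unique tiling with hole set S if and only if the rhombus graph of f contains no directed cycle. -/
theorem walk_of_transGen {α : Type*} {r : α → α → Prop} {a b : α} (h : Relation.TransGen r a b) :
    ∃ m : ℕ, 0 < m ∧ ∃ p : ℕ → α, p 0 = a ∧ p m = b ∧ ∀ i < m, r (p i) (p (i + 1)) := by
  induction h with
  | @single b hb =>
    refine ⟨1, one_pos, fun i => if i = 0 then a else b, by simp, by simp, ?_⟩
    intro i hi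
    have : i = 0 := by omega
    subst this
    simpa using hb
  | @tail b c _ hbc ih =>
    obtain ⟨m, hm, p, h0, h1, hp⟩ := ih
    refine ⟨m + 1, by omega, fun i => if i ≤ m then p i else c, by simp [h0], by simp, ?_⟩
    intro i hi
    rcases Nat.lt_or_ge i m with h | h
    · have h2 : i + 1 ≤ m := h
      have h3 : i ≤ m := h.le
      simpa [h2, h3] using hp i h
    · have : i = m := by omega
      subst this
      simpa [h1] using hbc

theorem simple_cycle {α : Type*} {r : α → α → Prop} {a : α} (h : Relation.TransGen r a a) :
    ∃ m : ℕ, 0 < m ∧ ∃ p : ℕ → α, p 0 = p m ∧ (∀ i < m, r (p i) (p (i + 1))) ∧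
      ∀ i j, i < m → j < m → p i = p j → i = j := by
  classical
  have hex : ∃ m : ℕ, 0 < m ∧ ∃ p : ℕ → α, p 0 = p m ∧ ∀ i < m, r (p i) (p (i + 1)) := by
    obtain ⟨m, hm, p, h0, h1, hp⟩ := walk_of_transGen h
    exact ⟨m, hm, p, h0.trans h1.symm, hp⟩
  obtain ⟨hm, p, h0, hp⟩ := Nat.find_spec hex
  have key : ∀ i j, i < j → j < Nat.find hex → p i ≠ p j := by
    intro i j hij hj he
    refine Nat.find_min hex (m := j - i) (by omega) ⟨by omega, fun k => p (i + k), ?_, ?_⟩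
    · simpa [Nat.add_sub_cancel' hij.le] using he
    · intro k hk
      exact hp (i + k) (by omega)
  refine ⟨_, hm, p, h0, hp, ?_⟩
  intro i j hi hj he
  rcases lt_trichotomy i j with h | h | h
  · exact absurd he (key i j h hj)
  · exact h
  · exact absurd he.symm (key j i h hi)

/-- A tiling `f` with hole set `S` is the unique tiling with hole set
`S` if and only if the rhombus graph of `f` contains no directed cycle. -/
theorem unique_tiling_iff_acyclic (n : ℕ) (hn : 0 < n) (S : Finset (ℕ × ℕ))
    (hS : ↑S ⊆ UpTri n) (hcard : S.card = n)
    (f : ℕ × ℕ → ℕ × ℕ) (hf : IsTiling n ↑S f) :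
    (∀ g : ℕ × ℕ → ℕ × ℕ, IsTiling n ↑S g → Set.EqOn g f (DownTri n)) ↔
      ¬ ∃ d : ℕ × ℕ, Relation.TransGen (RhEdge n f) d d := by
  classical
  constructor
  · rintro huniq ⟨d, hd⟩
    obtain ⟨m, hm, p, h0, hp, hinj⟩ := simple_cycle hd
    let ρ : ℕ × ℕ → ℕ × ℕ := fun d =>
      if h : ∃ i, i < m ∧ p (i + 1) = d then p h.choose else d
    have hon : ∀ d, (∃ i, i < m ∧ p (i + 1) = d) → ∃ i, i < m ∧ p (i + 1) = d ∧ ρ d = p i := by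
      intro d h
      exact ⟨h.choose, h.choose_spec.1, h.choose_spec.2, by simp only [ρ]; rw [dif_pos h]⟩
    have hoff : ∀ d, (¬ ∃ i, i < m ∧ p (i + 1) = d) → ρ d = d := by
      intro d h
      simp only [ρ]; rw [dif_neg h]
    have hcyc : ∀ i, i < m → ∃ k, k < m ∧ p (k + 1) = p i := by
      intro i hi
      rcases Nat.eq_zero_or_pos i with h | h
      · refine ⟨m - 1, by omega, ?_⟩
        rw [h, h0, Nat.sub_add_cancel hm]
      · exact ⟨i - 1, by omega, by rw [Nat.sub_add_cancel h]⟩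
    have hmaps : Set.MapsTo ρ (DownTri n) (DownTri n) := by
      intro d hd
      by_cases h : ∃ i, i < m ∧ p (i + 1) = d
      · obtain ⟨i, hi, _, h2⟩ := hon d h
        rw [h2]; exact (hp i hi).1
      · rw [hoff d h]; exact hd
    have hinjρ : Set.InjOn ρ (DownTri n) := by
      intro d _ e _ hde
      by_cases h : ∃ i, i < m ∧ p (i + 1) = d
      · obtain ⟨i, hi, h1, h2⟩ := hon d h
        by_cases h' : ∃ i, i < m ∧ p (i + 1) = e
        · obtain ⟨j, hj, h3, h4⟩ := hon e h'
          have : i = j := hinj i j hi hj (by rw [← h2, ← h4, hde])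
          rw [← h1, ← h3, this]
        · have h3 := hoff e h'
          exact absurd (by rw [← h3, ← hde, h2]; exact hcyc i hi) h'
      · have h1 := hoff d h
        by_cases h' : ∃ i, i < m ∧ p (i + 1) = e
        · obtain ⟨j, hj, h3, h4⟩ := hon e h'
          exact absurd (by rw [← h1, hde, h4]; exact hcyc j hj) h
        · rw [← h1, hde, hoff e h']
    have hbij : Set.BijOn ρ (DownTri n) (DownTri n) :=
      ((downTri_finite n).injOn_iff_bijOn_of_mapsTo hmaps).1 hinjρ
    have htil : IsTiling n ↑S (f ∘ ρ) := by
      refine ⟨hf.1.comp hbij, ?_⟩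
      intro d hd
      by_cases h : ∃ i, i < m ∧ p (i + 1) = d
      · obtain ⟨i, hi, h1, h2⟩ := hon d h
        simp only [Function.comp, h2]
        rw [← h1]; exact (hp i hi).2.2.2
      · simp only [Function.comp, hoff d h]
        exact hf.2 d hd
    obtain ⟨i, hi, h1, h2⟩ := hon (p (0 + 1)) ⟨0, hm, rfl⟩
    have hD := (hp i hi)
    have heq := huniq _ htil hD.2.1
    rw [h1] at heq
    simp only [Function.comp, h2] at heq
    rw [← h1] at heq
    exact hD.2.2.1 (hf.1.injOn hD.1 hD.2.1 heq)
  · intro hac g hg d0 hd0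
    by_contra hne
    apply hac
    have hex : ∀ d, ∃ e, d ∈ DownTri n → e ∈ DownTri n ∧ g e = f d := by
      intro d
      by_cases hd : d ∈ DownTri n
      · obtain ⟨e, he, h⟩ := hg.1.surjOn (hf.1.mapsTo hd)
        exact ⟨e, fun _ => ⟨he, h⟩⟩
      · exact ⟨d, fun h => absurd h hd⟩
    choose τ hτ using hex
    have hstep : ∀ k, τ^[k] d0 ∈ DownTri n ∧ g (τ^[k] d0) ≠ f (τ^[k] d0) := by
      intro k
      induction k with
      | zero => exact ⟨hd0, hne⟩
      | succ k ih =>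
        rw [Function.iterate_succ_apply']
        obtain ⟨h1, h2⟩ := hτ _ ih.1
        refine ⟨h1, fun h => ih.2 ?_⟩
        have h3 := hf.1.injOn ih.1 h1 (h2.symm.trans h)
        rw [← h3] at h2
        exact h2
    have hedge : ∀ k, RhEdge n f (τ^[k] d0) (τ^[k + 1] d0) := by
      intro k
      rw [Function.iterate_succ_apply']
      obtain ⟨h1, h2⟩ := hτ _ (hstep k).1
      refine ⟨(hstep k).1, h1, fun h => (hstep k).2 ?_, ?_⟩
      · rw [← h] at h2; exact h2
      · rw [← h2]; exact hg.2 _ h1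
    have htr : ∀ i k, Relation.TransGen (RhEdge n f) (τ^[i] d0) (τ^[i + k + 1] d0) := by
      intro i k
      induction k with
      | zero => exact .single (hedge i)
      | succ k ih => exact ih.tail (hedge (i + k + 1))
    obtain ⟨i, _, j, _, hij, he⟩ := Set.infinite_univ.exists_lt_map_eq_of_mapsTo
      (f := fun k : ℕ => τ^[k] d0) (fun k _ => (hstep k).1) (downTri_finite n)
    refine ⟨τ^[i] d0, ?_⟩
    have h := htr i (j - i - 1)
    have hj : i + (j - i - 1) + 1 = j := by omega
    rw [hj] at h
    rw [← he] at h
    exact h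
end

section
/- Let n ≥ 3 and let R be the set of upward and downward unit triangles of Δ other than the three corner upward unit triangles (0,0), (n−1,0), (0,n−1) and the cells of the central upward subtriangle T(1,1,n−3). Then there are exactly two bijections f from the downward unit triangles of R onto the upward unit triangles of R with f(d) adjacent to d for every d; moreover in one of them f((0,0)) = (0,1) and in the other f((0,0)) = (1,0). -/
/-- The upward unit triangles of the GD ring `R(a,b,m)`: upward cells of `T(a,b,m)` other
than the three corners and the cells of the central subtriangle `T(a+1,b+1,m-3)`. -/
def RingUp (a b m : ℕ) : Set (ℕ × ℕ) :=
  UpCells a b m \ ({(a, b), (a + m - 1, b), (a, b + m - 1)} ∪ UpCells (a + 1) (b + 1) (m - 3))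

/-- The downward unit triangles of the GD ring `R(a,b,m)`. -/
def RingDown (a b m : ℕ) : Set (ℕ × ℕ) :=
  DownCells a b m \ DownCells (a + 1) (b + 1) (m - 3)

/-- `f` contains a clockwise GD at `(a,b,m)`. -/
def CWGD (f : ℕ × ℕ → ℕ × ℕ) (a b m : ℕ) : Prop :=
  f '' RingDown a b m = RingUp a b m ∧ f (a, b) = (a, b + 1)

/-- `f` contains a counterclockwise GD at `(a,b,m)`. -/
def CCWGD (f : ℕ × ℕ → ℕ × ℕ) (a b m : ℕ) : Prop :=
  f '' RingDown a b m = RingUp a b m ∧ f (a, b) = (a + 1, b)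

/-- `g` is obtained from `f` by a GD flip at `(a,b,m)`. -/
def GDFlipAt (n : ℕ) (f g : ℕ × ℕ → ℕ × ℕ) (a b m : ℕ) : Prop :=
  3 ≤ m ∧ a + b + m ≤ n ∧ CWGD f a b m ∧ CCWGD g a b m ∧
    (∃ S : Set (ℕ × ℕ), IsTiling n S f ∧ IsTiling n S g) ∧
    ∀ d ∈ DownTri n, d ∉ RingDown a b m → g d = f d

/-- `g` is obtained from `f` by a GD flip (at some position). -/
def GDFlip (n : ℕ) (f g : ℕ × ℕ → ℕ × ℕ) : Prop :=
  ∃ a b m, GDFlipAt n f g a b m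

theorem mem_ringDown_iff (n : ℕ) (hn : 3 ≤ n) (i j : ℕ) :
    (i, j) ∈ RingDown 0 0 n ↔ i + j + 2 ≤ n ∧ (i = 0 ∨ j = 0 ∨ i + j + 2 = n) := by
  simp only [RingDown, DownCells, Set.mem_sdiff, Set.mem_ofPred_eq]
  omega

theorem mem_ringUp_iff (n : ℕ) (hn : 3 ≤ n) (i j : ℕ) :
    (i, j) ∈ RingUp 0 0 n ↔ i + j + 1 ≤ n ∧ (i = 0 ∨ j = 0 ∨ i + j + 1 = n) ∧
      ¬ (i = 0 ∧ j = 0) ∧ ¬ (i + 1 = n) ∧ ¬ (j + 1 = n) := by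
  simp only [RingUp, UpCells, Set.mem_sdiff, Set.mem_ofPred_eq, Set.mem_union,
    Set.mem_insert_iff, Set.mem_singleton_iff, Prod.mk.injEq]
  omega

/-- The tiling of the ring with `(0,0) ↦ (0,1)`. -/
def ringOne (n : ℕ) (d : ℕ × ℕ) : ℕ × ℕ :=
  if d.1 + d.2 + 2 = n then (if d.2 = 0 then d else (d.1 + 1, d.2))
  else if d.1 = 0 then (d.1, d.2 + 1) else d

/-- The tiling of the ring with `(0,0) ↦ (1,0)`. -/
def ringTwo (n : ℕ) (d : ℕ × ℕ) : ℕ × ℕ :=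
  if d.1 + d.2 + 2 = n then (if d.1 = 0 then d else (d.1, d.2 + 1))
  else if d.2 = 0 then (d.1 + 1, d.2) else d

theorem ringOne_bijOn (n : ℕ) (hn : 3 ≤ n) :
    Set.BijOn (ringOne n) (RingDown 0 0 n) (RingUp 0 0 n) := by
  refine ⟨?_, ?_, ?_⟩
  · rintro ⟨i, j⟩ h
    rw [mem_ringDown_iff n hn] at h
    simp only [ringOne]
    split_ifs <;> rw [mem_ringUp_iff n hn] <;> omega
  · rintro ⟨i, j⟩ h ⟨k, l⟩ h' e
    rw [mem_ringDown_iff n hn] at h h'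
    simp only [ringOne] at e
    split_ifs at e <;> simp only [Prod.mk.injEq] at e ⊢ <;> omega
  · rintro ⟨i, j⟩ h
    rw [mem_ringUp_iff n hn] at h
    by_cases hi : i = 0
    · refine ⟨(i, j - 1), (mem_ringDown_iff n hn _ _).2 (by omega), ?_⟩
      simp only [ringOne]
      split_ifs <;> rw [Prod.mk.injEq] <;> omega
    by_cases hj : j = 0
    · refine ⟨(i, j), (mem_ringDown_iff n hn _ _).2 (by omega), ?_⟩
      simp only [ringOne]
      split_ifs <;> rw [Prod.mk.injEq] <;> omega
    · refine ⟨(i - 1, j), (mem_ringDown_iff n hn _ _).2 (by omega), ?_⟩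
      simp only [ringOne]
      split_ifs <;> rw [Prod.mk.injEq] <;> omega

theorem ringTwo_bijOn (n : ℕ) (hn : 3 ≤ n) :
    Set.BijOn (ringTwo n) (RingDown 0 0 n) (RingUp 0 0 n) := by
  refine ⟨?_, ?_, ?_⟩
  · rintro ⟨i, j⟩ h
    rw [mem_ringDown_iff n hn] at h
    simp only [ringTwo]
    split_ifs <;> rw [mem_ringUp_iff n hn] <;> omega
  · rintro ⟨i, j⟩ h ⟨k, l⟩ h' e
    rw [mem_ringDown_iff n hn] at h h'
    simp only [ringTwo] at e
    split_ifs at e <;> simp only [Prod.mk.injEq] at e ⊢ <;> omega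
  · rintro ⟨i, j⟩ h
    rw [mem_ringUp_iff n hn] at h
    by_cases hj : j = 0
    · refine ⟨(i - 1, j), (mem_ringDown_iff n hn _ _).2 (by omega), ?_⟩
      simp only [ringTwo]
      split_ifs <;> rw [Prod.mk.injEq] <;> omega
    by_cases hi : i = 0
    · refine ⟨(i, j), (mem_ringDown_iff n hn _ _).2 (by omega), ?_⟩
      simp only [ringTwo]
      split_ifs <;> rw [Prod.mk.injEq] <;> omega
    · refine ⟨(i, j - 1), (mem_ringDown_iff n hn _ _).2 (by omega), ?_⟩
      simp only [ringTwo]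
      split_ifs <;> rw [Prod.mk.injEq] <;> omega

section Unique

variable {n : ℕ} {g : ℕ × ℕ → ℕ × ℕ}

/-- Each downward triangle of the ring has only the two images `ringOne`, `ringTwo`. -/
theorem ring_two_choices (hn : 3 ≤ n) (hm : Set.MapsTo g (RingDown 0 0 n) (RingUp 0 0 n))
    (ha : ∀ d ∈ RingDown 0 0 n, Adj d (g d)) (d : ℕ × ℕ) (hd : d ∈ RingDown 0 0 n) :
    g d = ringOne n d ∨ g d = ringTwo n d := by
  obtain ⟨i, j⟩ := d
  have h1 := hm hd
  have h2 := ha _ hd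
  rw [mem_ringDown_iff n hn] at hd
  simp only [ringOne, ringTwo]
  rcases h2 with h2 | h2 | h2 <;> rw [h2] at h1 ⊢ <;> rw [mem_ringUp_iff n hn] at h1 <;>
    split_ifs <;> simp only [Prod.mk.injEq] <;> grind

/-- The choice of ringOne propagates along the ring. -/
theorem ringOne_step (hn : 3 ≤ n) (hb : Set.BijOn g (RingDown 0 0 n) (RingUp 0 0 n))
    (ha : ∀ d ∈ RingDown 0 0 n, Adj d (g d)) (i j k l : ℕ)
    (hd : (i, j) ∈ RingDown 0 0 n) (hd' : (k, l) ∈ RingDown 0 0 n)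
    (hne : ¬ (i = k ∧ j = l)) (h : g (i, j) = ringOne n (i, j))
    (e : ringTwo n (k, l) = ringOne n (i, j)) : g (k, l) = ringOne n (k, l) := by
  rcases ring_two_choices hn hb.mapsTo ha _ hd' with h' | h'
  · exact h'
  · have := hb.injOn hd hd' (by rw [h, h', e])
    simp only [Prod.mk.injEq] at this
    exact absurd this hne

theorem ringTwo_step (hn : 3 ≤ n) (hb : Set.BijOn g (RingDown 0 0 n) (RingUp 0 0 n))
    (ha : ∀ d ∈ RingDown 0 0 n, Adj d (g d)) (i j k l : ℕ)
    (hd : (i, j) ∈ RingDown 0 0 n) (hd' : (k, l) ∈ RingDown 0 0 n)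
    (hne : ¬ (i = k ∧ j = l)) (h : g (i, j) = ringTwo n (i, j))
    (e : ringOne n (k, l) = ringTwo n (i, j)) : g (k, l) = ringTwo n (k, l) := by
  rcases ring_two_choices hn hb.mapsTo ha _ hd' with h' | h'
  · have := hb.injOn hd hd' (by rw [h, h', e])
    simp only [Prod.mk.injEq] at this
    exact absurd this hne
  · exact h'

theorem ringOne_unique (hn : 3 ≤ n) (hb : Set.BijOn g (RingDown 0 0 n) (RingUp 0 0 n))
    (ha : ∀ d ∈ RingDown 0 0 n, Adj d (g d)) (h0 : g (0, 0) = ringOne n (0, 0)) :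
    Set.EqOn g (ringOne n) (RingDown 0 0 n) := by
  have A : ∀ j, j + 2 ≤ n → g (0, j) = ringOne n (0, j) := by
    intro j
    induction j with
    | zero => intro _; exact h0
    | succ j ih =>
      intro hj
      refine ringOne_step hn hb ha 0 j 0 (j + 1) ((mem_ringDown_iff n hn _ _).2 (by omega))
        ((mem_ringDown_iff n hn _ _).2 (by omega)) (by omega) (ih (by omega)) ?_
      simp only [ringOne, ringTwo]
      grind
  have B : ∀ k l, k + l + 2 = n → g (k, l) = ringOne n (k, l) := by
    intro k
    induction k with
    | zero => intro l hl; exact A l (by omega)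
    | succ k ih =>
      intro l hl
      refine ringOne_step hn hb ha k (l + 1) (k + 1) l ((mem_ringDown_iff n hn _ _).2 (by omega))
        ((mem_ringDown_iff n hn _ _).2 (by omega)) (by omega) (ih (l + 1) (by omega)) ?_
      simp only [ringOne, ringTwo]
      grind
  have C : ∀ m i, i + m + 2 = n → 1 ≤ i → g (i, 0) = ringOne n (i, 0) := by
    intro m
    induction m with
    | zero => intro i hi _; exact B i 0 (by omega)
    | succ m ih =>
      intro i hi hi1
      refine ringOne_step hn hb ha (i + 1) 0 i 0 ((mem_ringDown_iff n hn _ _).2 (by omega))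
        ((mem_ringDown_iff n hn _ _).2 (by omega)) (by omega) (ih (i + 1) (by omega) (by omega)) ?_
      simp only [ringOne, ringTwo]
      grind
  rintro ⟨i, j⟩ hd
  rw [mem_ringDown_iff n hn] at hd
  obtain ⟨hs, h | h | h⟩ := hd
  · subst h; exact A j (by omega)
  · subst h
    rcases Nat.eq_zero_or_pos i with h | h
    · subst h; exact h0
    · exact C (n - 2 - i) i (by omega) h
  · exact B i j h

theorem ringTwo_unique (hn : 3 ≤ n) (hb : Set.BijOn g (RingDown 0 0 n) (RingUp 0 0 n))
    (ha : ∀ d ∈ RingDown 0 0 n, Adj d (g d)) (h0 : g (0, 0) = ringTwo n (0, 0)) :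
    Set.EqOn g (ringTwo n) (RingDown 0 0 n) := by
  have A : ∀ i, i + 2 ≤ n → g (i, 0) = ringTwo n (i, 0) := by
    intro i
    induction i with
    | zero => intro _; exact h0
    | succ i ih =>
      intro hi
      refine ringTwo_step hn hb ha i 0 (i + 1) 0 ((mem_ringDown_iff n hn _ _).2 (by omega))
        ((mem_ringDown_iff n hn _ _).2 (by omega)) (by omega) (ih (by omega)) ?_
      simp only [ringOne, ringTwo]
      grind
  have B : ∀ l k, k + l + 2 = n → g (k, l) = ringTwo n (k, l) := by
    intro l
    induction l with
    | zero => intro k hk; exact A k (by omega)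
    | succ l ih =>
      intro k hk
      refine ringTwo_step hn hb ha (k + 1) l k (l + 1) ((mem_ringDown_iff n hn _ _).2 (by omega))
        ((mem_ringDown_iff n hn _ _).2 (by omega)) (by omega) (ih (k + 1) (by omega)) ?_
      simp only [ringOne, ringTwo]
      grind
  have C : ∀ m j, j + m + 2 = n → 1 ≤ j → g (0, j) = ringTwo n (0, j) := by
    intro m
    induction m with
    | zero => intro j hj _; exact B j 0 (by omega)
    | succ m ih =>
      intro j hj hj1
      refine ringTwo_step hn hb ha 0 (j + 1) 0 j ((mem_ringDown_iff n hn _ _).2 (by omega))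
        ((mem_ringDown_iff n hn _ _).2 (by omega)) (by omega) (ih (j + 1) (by omega) (by omega)) ?_
      simp only [ringOne, ringTwo]
      grind
  rintro ⟨i, j⟩ hd
  rw [mem_ringDown_iff n hn] at hd
  obtain ⟨hs, h | h | h⟩ := hd
  · subst h
    rcases Nat.eq_zero_or_pos j with h | h
    · subst h; exact h0
    · exact C (n - 2 - j) j (by omega) h
  · subst h; exact A i (by omega)
  · exact B j i h

end Unique

/-- For `n ≥ 3`, the GD ring `R(0,0,n)` (Δ minus its three corner
upward triangles and the central `T(1,1,n-3)`) admits exactly two rhombus tilings: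
one with `f (0,0) = (0,1)` and one with `f (0,0) = (1,0)`. -/
theorem gd_ring_two_tilings (n : ℕ) (hn : 3 ≤ n) :
    ∃ f₁ f₂ : ℕ × ℕ → ℕ × ℕ,
      (Set.BijOn f₁ (RingDown 0 0 n) (RingUp 0 0 n) ∧
        ∀ d ∈ RingDown 0 0 n, Adj d (f₁ d)) ∧
      (Set.BijOn f₂ (RingDown 0 0 n) (RingUp 0 0 n) ∧
        ∀ d ∈ RingDown 0 0 n, Adj d (f₂ d)) ∧
      f₁ (0, 0) = (0, 1) ∧ f₂ (0, 0) = (1, 0) ∧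
      ∀ g : ℕ × ℕ → ℕ × ℕ,
        (Set.BijOn g (RingDown 0 0 n) (RingUp 0 0 n) ∧
          ∀ d ∈ RingDown 0 0 n, Adj d (g d)) →
        Set.EqOn g f₁ (RingDown 0 0 n) ∨ Set.EqOn g f₂ (RingDown 0 0 n) := by
  refine ⟨ringOne n, ringTwo n, ⟨ringOne_bijOn n hn, ?_⟩, ⟨ringTwo_bijOn n hn, ?_⟩, ?_, ?_, ?_⟩
  · rintro ⟨i, j⟩ _
    simp only [ringOne, Adj]
    split_ifs <;> simp
  · rintro ⟨i, j⟩ _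
    simp only [ringTwo, Adj]
    split_ifs <;> simp
  · simp only [ringOne]
    split_ifs <;> rw [Prod.mk.injEq] <;> omega
  · simp only [ringTwo]
    split_ifs <;> rw [Prod.mk.injEq] <;> omega
  · rintro g ⟨hb, ha⟩
    rcases ring_two_choices hn hb.mapsTo ha (0, 0)
      ((mem_ringDown_iff n hn _ _).2 (by omega)) with h | h
    · exact Or.inl (ringOne_unique hn hb ha h)
    · exact Or.inr (ringTwo_unique hn hb ha h)
end
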